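/- Suppose [·,·] is a Lie bracket on ℝ^7 and Λ : ℝ^7 → 𝔤𝔩(7,ℝ) is a linear map with Λ(x)y − Λ(y)x = [x,y] and Λ(x) ∈ 𝔤₂* for all x,y ∈ ℝ^7. If the infinitesimal holonomy 𝔥 equals 𝔞 ⋉ 𝔪(1,0,k), one of the listed type III algebras, then 𝔞 = 0; in other words, 𝔥 never equals 𝔞 ⋉ 𝔪(1,0,k) for 𝔞 ∈ {𝔰𝔩(2,ℝ), 𝔤𝔩(2,ℝ), 𝔠𝔬(2), 𝔡, ℝ·diag(1,0)}, so among the listed algebras only the abelian ones 𝔪(1,0,1) and 𝔪(1,0,2) can occur as 𝔥. -/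

import Mathlib

open Matrix

noncomputable section

abbrev V7 : Type := Fin 7 → ℝ
abbrev M7 : Type := Matrix (Fin 7) (Fin 7) ℝ
abbrev M2 : Type := Matrix (Fin 2) (Fin 2) ℝ

/-- The standard basis of `ℝ^7` (0-indexed: `e 0` is `e_1` of the paper). -/
def e (i : Fin 7) : V7 := Pi.single i 1

/-- The matrix `X(s)` (indices shifted: `s 0 = s_1`, …, `s 13 = s_14`). -/
def Xg2 (s : Fin 14 → ℝ) : M7 :=
  !![s 0 + s 3, -s 9, s 8, Real.sqrt 2 * s 5, 0, -s 10, -s 11;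
     -s 7, s 0, s 1, Real.sqrt 2 * s 8, s 10, 0, s 5;
     s 6, s 2, s 3, Real.sqrt 2 * s 9, s 11, -s 5, 0;
     Real.sqrt 2 * s 4, Real.sqrt 2 * s 6, Real.sqrt 2 * s 7, 0,
       Real.sqrt 2 * s 5, Real.sqrt 2 * s 8, Real.sqrt 2 * s 9;
     0, s 12, s 13, Real.sqrt 2 * s 4, -s 0 - s 3, s 7, -s 6;
     -s 12, 0, -s 4, Real.sqrt 2 * s 6, s 9, -s 0, -s 2;
     -s 13, s 4, 0, Real.sqrt 2 * s 7, -s 8, -s 1, -s 3]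

/-- `𝔤₂* = {X(s) : s ∈ ℝ^14}`. -/
def g2star : Set M7 := Set.range Xg2

/-- The matrix `h(A,v,u,y)`. -/
def hmat (A : M2) (v : ℝ) (u y : Fin 2 → ℝ) : M7 :=
  !![A 0 0 + A 1 1, -u 1, u 0, Real.sqrt 2 * v, 0, -y 0, -y 1;
     0, A 0 0, A 0 1, Real.sqrt 2 * u 0, y 0, 0, v;
     0, A 1 0, A 1 1, Real.sqrt 2 * u 1, y 1, -v, 0;
     0, 0, 0, 0, Real.sqrt 2 * v, Real.sqrt 2 * u 0, Real.sqrt 2 * u 1;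
     0, 0, 0, 0, -(A 0 0 + A 1 1), 0, 0;
     0, 0, 0, 0, u 1, -A 0 0, -A 1 0;
     0, 0, 0, 0, -u 0, -A 0 1, -A 1 1]

/-- `𝔥^I = {h(A,v,u,y)}`. -/
def hI : Set M7 := {X | ∃ A v u y, X = hmat A v u y}

/-- The matrix `h(A,v,y) := h(A,v,0,y)`. -/
def h3 (A : M2) (v : ℝ) (y : Fin 2 → ℝ) : M7 := hmat A v 0 y

/-- `𝔥^III = {h(A,v,y)}`. -/
def hIII : Set M7 := {X | ∃ A v y, X = h3 A v y}

/-- `𝔪(1,0,1) = {h(0,v,(y_1,0))}`. -/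
def m101 : Set M7 := {X | ∃ v y1, X = h3 0 v ![y1, 0]}

/-- `𝔪(1,0,2) = {h(0,v,(y_1,y_2))}`. -/
def m102 : Set M7 := {X | ∃ v y, X = h3 0 v y}

/-- The curvature `R(x,y) = Λ(x)Λ(y) − Λ(y)Λ(x) − Λ([x,y])`. -/
def curv (L : V7 →ₗ[ℝ] M7) (bk : V7 → V7 → V7) (x y : V7) : M7 :=
  L x * L y - L y * L x - L (bk x y)

/-- The infinitesimal holonomy: the smallest linear subspace of `𝔤𝔩(7,ℝ)` containing
all `R(x,y)` and stable under bracketing with all `Λ(z)`. -/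
def infHol (L : V7 →ₗ[ℝ] M7) (bk : V7 → V7 → V7) : Submodule ℝ M7 :=
  sInf {H : Submodule ℝ M7 | (∀ x y, curv L bk x y ∈ H) ∧
    ∀ z : V7, ∀ X ∈ H, L z * X - X * L z ∈ H}

/-- `𝔰𝔩(2,ℝ)` as a set of 2×2 matrices. -/
def sl2 : Set M2 := {A | A 0 0 + A 1 1 = 0}

/-- `𝔤𝔩(2,ℝ)` as a set of 2×2 matrices. -/
def gl2 : Set M2 := Set.univ

/-- `𝔠𝔬(2) = {(a,−b;b,a)}`. -/
def co2 : Set M2 := {A | ∃ a b : ℝ, A = !![a, -b; b, a]}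

/-- `𝔡`, the diagonal 2×2 matrices. -/
def dd : Set M2 := {A | A 0 1 = 0 ∧ A 1 0 = 0}

/-- `ℝ·diag(1,0)`. -/
def rdiag10 : Set M2 := {A | ∃ t : ℝ, A = !![t, 0; 0, 0]}

/-- `𝔞 ⋉ 𝔪(1,0,k)`. -/
def semidir (a : Set M2) : ℕ → Set M7
  | 1 => {X | ∃ A ∈ a, ∃ v y1, X = h3 A v ![y1, 0]}
  | _ => {X | ∃ A ∈ a, ∃ v y, X = h3 A v y}

/-- The pairs `(𝔞, k)` occurring in the list of type III holonomy algebras. -/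
def ListedPair (a : Set M2) (k : ℕ) : Prop :=
  ((a = sl2 ∨ a = gl2 ∨ a = co2 ∨ a = dd) ∧ k = 2) ∨
  ((a = ({0} : Set M2) ∨ a = rdiag10) ∧ (k = 1 ∨ k = 2))

/-- The listed type III holonomy algebras `𝔞 ⋉ 𝔪(1,0,k)`. -/
def ListedTypeIII (S : Set M7) : Prop := ∃ a k, ListedPair a k ∧ S = semidir a k

/-- Parameters `(a, b, c, d, v, y₁, y₂, u₁, u₂)` of an element of `𝔥^I`. -/
abbrev Prm (K : Type*) : Type _ := Fin 9 → K

section Model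

variable {K : Type*} [Field K]

/-- The element of `𝔥^I` with given parameters, after rescaling `e_4` to avoid `√2`. -/
def hm (p : Prm K) : Matrix (Fin 7) (Fin 7) K :=
  !![p 0 + p 3, -p 8, p 7, 2 * p 4, 0, -p 5, -p 6;
     0, p 0, p 1, 2 * p 7, p 5, 0, p 4;
     0, p 2, p 3, 2 * p 8, p 6, -p 4, 0;
     0, 0, 0, 0, p 4, p 7, p 8;
     0, 0, 0, 0, -(p 0 + p 3), 0, 0;
     0, 0, 0, 0, p 8, -p 0, -p 2;
     0, 0, 0, 0, -p 7, -p 1, -p 3]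

/-- The commutator on `𝔥^I` in terms of parameters. -/
def br (p q : Prm K) : Prm K :=
  ![p 1 * q 2 - p 2 * q 1,
    p 0 * q 1 - p 1 * q 0 + p 1 * q 3 - p 3 * q 1,
    p 2 * q 0 - p 0 * q 2 - p 2 * q 3 + p 3 * q 2,
    p 2 * q 1 - p 1 * q 2,
    p 0 * q 4 + p 3 * q 4 - p 4 * q 0 - p 4 * q 3 + 2 * p 7 * q 8 - 2 * p 8 * q 7,
    2 * p 0 * q 5 + p 1 * q 6 + p 3 * q 5 - 3 * p 4 * q 7 - 2 * p 5 * q 0 - p 5 * q 3 - p 6 * q 1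
      + 3 * p 7 * q 4,
    p 0 * q 6 + p 2 * q 5 + 2 * p 3 * q 6 - 3 * p 4 * q 8 - p 5 * q 2 - p 6 * q 0 - 2 * p 6 * q 3
      + 3 * p 8 * q 4,
    p 0 * q 7 + p 1 * q 8 - p 7 * q 0 - p 8 * q 1,
    p 2 * q 7 + p 3 * q 8 - p 7 * q 2 - p 8 * q 3]

theorem hm_apply (p : Prm K) :
    (hm p 0 0 = p 0 + p 3 ∧ hm p 0 1 = -p 8 ∧ hm p 0 2 = p 7 ∧ hm p 0 3 = 2 * p 4 ∧
      hm p 0 4 = 0 ∧ hm p 0 5 = -p 5 ∧ hm p 0 6 = -p 6) ∧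
    (hm p 1 0 = 0 ∧ hm p 1 1 = p 0 ∧ hm p 1 2 = p 1 ∧ hm p 1 3 = 2 * p 7 ∧
      hm p 1 4 = p 5 ∧ hm p 1 5 = 0 ∧ hm p 1 6 = p 4) ∧
    (hm p 2 0 = 0 ∧ hm p 2 1 = p 2 ∧ hm p 2 2 = p 3 ∧ hm p 2 3 = 2 * p 8 ∧
      hm p 2 4 = p 6 ∧ hm p 2 5 = -p 4 ∧ hm p 2 6 = 0) ∧
    (hm p 3 0 = 0 ∧ hm p 3 1 = 0 ∧ hm p 3 2 = 0 ∧ hm p 3 3 = 0 ∧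
      hm p 3 4 = p 4 ∧ hm p 3 5 = p 7 ∧ hm p 3 6 = p 8) ∧
    (hm p 4 0 = 0 ∧ hm p 4 1 = 0 ∧ hm p 4 2 = 0 ∧ hm p 4 3 = 0 ∧
      hm p 4 4 = -(p 0 + p 3) ∧ hm p 4 5 = 0 ∧ hm p 4 6 = 0) ∧
    (hm p 5 0 = 0 ∧ hm p 5 1 = 0 ∧ hm p 5 2 = 0 ∧ hm p 5 3 = 0 ∧
      hm p 5 4 = p 8 ∧ hm p 5 5 = -p 0 ∧ hm p 5 6 = -p 2) ∧
    (hm p 6 0 = 0 ∧ hm p 6 1 = 0 ∧ hm p 6 2 = 0 ∧ hm p 6 3 = 0 ∧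
      hm p 6 4 = -p 7 ∧ hm p 6 5 = -p 1 ∧ hm p 6 6 = -p 3) := by
  refine ⟨⟨?_, ?_, ?_, ?_, ?_, ?_, ?_⟩, ⟨?_, ?_, ?_, ?_, ?_, ?_, ?_⟩, ⟨?_, ?_, ?_, ?_, ?_, ?_, ?_⟩,
    ⟨?_, ?_, ?_, ?_, ?_, ?_, ?_⟩, ⟨?_, ?_, ?_, ?_, ?_, ?_, ?_⟩, ⟨?_, ?_, ?_, ?_, ?_, ?_, ?_⟩,
    ?_, ?_, ?_, ?_, ?_, ?_, ?_⟩ <;> rfl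

theorem br_apply (p q : Prm K) :
    br p q 0 = p 1 * q 2 - p 2 * q 1 ∧
    br p q 1 = p 0 * q 1 - p 1 * q 0 + p 1 * q 3 - p 3 * q 1 ∧
    br p q 2 = p 2 * q 0 - p 0 * q 2 - p 2 * q 3 + p 3 * q 2 ∧
    br p q 3 = p 2 * q 1 - p 1 * q 2 ∧
    br p q 4 = p 0 * q 4 + p 3 * q 4 - p 4 * q 0 - p 4 * q 3 + 2 * p 7 * q 8 - 2 * p 8 * q 7 ∧
    br p q 5 = 2 * p 0 * q 5 + p 1 * q 6 + p 3 * q 5 - 3 * p 4 * q 7 - 2 * p 5 * q 0 - p 5 * q 3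
      - p 6 * q 1 + 3 * p 7 * q 4 ∧
    br p q 6 = p 0 * q 6 + p 2 * q 5 + 2 * p 3 * q 6 - 3 * p 4 * q 8 - p 5 * q 2 - p 6 * q 0
      - 2 * p 6 * q 3 + 3 * p 8 * q 4 ∧
    br p q 7 = p 0 * q 7 + p 1 * q 8 - p 7 * q 0 - p 8 * q 1 ∧
    br p q 8 = p 2 * q 7 + p 3 * q 8 - p 7 * q 2 - p 8 * q 3 :=
  ⟨rfl, rfl, rfl, rfl, rfl, rfl, rfl, rfl, rfl⟩

/-- The parameters of `h(A, v, y)`. -/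
def prm3 (a b c d v y z : K) : Prm K :=
  ![a, b, c, d, v, y, z, 0, 0]

theorem prm3_apply (a b c d v y z : K) :
    prm3 a b c d v y z 0 = a ∧ prm3 a b c d v y z 1 = b ∧ prm3 a b c d v y z 2 = c ∧
    prm3 a b c d v y z 3 = d ∧ prm3 a b c d v y z 4 = v ∧ prm3 a b c d v y z 5 = y ∧
    prm3 a b c d v y z 6 = z ∧ prm3 a b c d v y z 7 = 0 ∧ prm3 a b c d v y z 8 = 0 :=
  ⟨rfl, rfl, rfl, rfl, rfl, rfl, rfl, rfl, rfl⟩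

/-- The torsion-free bracket of a connection given by parameters `w i` of `Λ(e_i)`. -/
def tor (w : Fin 7 → Prm K) (i j k : Fin 7) : K := hm (w i) k j - hm (w j) k i

/-- The identities satisfied by the curvature parameters of a torsion-free connection. -/
structure CurvSys (w : Fin 7 → Prm K) (ρ : Fin 7 → Fin 7 → Prm K) : Prop where
  skew : ∀ i j, ρ j i = -ρ i j
  def_eq : ∀ i j m, br (w i) (w j) m - ∑ k, tor w i j k * w k m = ρ i j m
  first : ∀ i j k l, hm (ρ i j) l k + hm (ρ j k) l i - hm (ρ i k) l j = 0
  second : ∀ i j k m, (br (w i) (ρ j k) m - ∑ l, tor w i j l * ρ l k m) +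
    (br (w k) (ρ i j) m - ∑ l, tor w j k l * ρ l i m) -
    (br (w j) (ρ i k) m - ∑ l, tor w i k l * ρ l j m) = 0

/-- The increasing pairs of indices. -/
def pairs : List (Fin 7 × Fin 7) :=
  [(0, 1), (0, 2), (0, 3), (0, 4), (0, 5), (0, 6), (1, 2), (1, 3), (1, 4), (1, 5), (1, 6),
   (2, 3), (2, 4), (2, 5), (2, 6), (3, 4), (3, 5), (3, 6), (4, 5), (4, 6), (5, 6)]

/-- The increasing triples of indices. -/
def triples : List (Fin 7 × Fin 7 × Fin 7) :=
  pairs.flatMap fun p => (List.finRange 7).filterMap fun k =>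
    if p.2 < k then some (p.1, p.2, k) else none

theorem triples_eq : triples =
    [(0, 1, 2), (0, 1, 3), (0, 1, 4), (0, 1, 5), (0, 1, 6), (0, 2, 3), (0, 2, 4), (0, 2, 5),
     (0, 2, 6), (0, 3, 4), (0, 3, 5), (0, 3, 6), (0, 4, 5), (0, 4, 6), (0, 5, 6), (1, 2, 3),
     (1, 2, 4), (1, 2, 5), (1, 2, 6), (1, 3, 4), (1, 3, 5), (1, 3, 6), (1, 4, 5), (1, 4, 6),
     (1, 5, 6), (2, 3, 4), (2, 3, 5), (2, 3, 6), (2, 4, 5), (2, 4, 6), (2, 5, 6), (3, 4, 5),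
     (3, 4, 6), (3, 5, 6), (4, 5, 6)] := by
  decide

/-- The general solution of the first Bianchi identity in `𝔥^III`. -/
def tab (t : Fin 5 → K) (a₅ b₅ a₆ b₆ c₆ d₆ v₅ v₆ y₅ y₆ z₆ : K) :
    Matrix (Fin 7) (Fin 7) (Prm K) :=
  let r04 := prm3 0 0 0 0 0 (a₅ + b₆) (a₆ + d₆)
  let r15 := prm3 (t 2) (t 3) (-t 1) (-t 2) 0 a₅ a₆
  let r16 := prm3 (-t 1) (-t 2) (t 0) (t 1) 0 a₆ c₆
  let r25 := prm3 (t 3) (t 4) (-t 2) (-t 3) 0 b₅ b₆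
  let r26 := prm3 (-t 2) (-t 3) (t 1) (t 2) 0 b₆ d₆
  let r34 := prm3 0 0 0 0 0 (2 * v₅) (2 * v₆)
  let r45 := prm3 a₅ b₅ a₆ b₆ v₅ y₅ y₆
  let r46 := prm3 a₆ b₆ c₆ d₆ v₆ y₆ z₆
  let r56 := prm3 0 0 0 0 0 (-v₅) (-v₆)
  !![0, 0, 0, 0, r04, 0, 0;
     0, 0, 0, 0, 0, r15, r16;
     0, 0, 0, 0, 0, r25, r26;
     0, 0, 0, 0, r34, 0, 0;
     -r04, 0, 0, -r34, 0, r45, r46;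
     0, -r15, -r25, 0, -r45, 0, r56;
     0, -r16, -r26, 0, -r46, -r56, 0]

theorem tab_apply (t : Fin 5 → K) (a₅ b₅ a₆ b₆ c₆ d₆ v₅ v₆ y₅ y₆ z₆ : K) :
    let T := tab t a₅ b₅ a₆ b₆ c₆ d₆ v₅ v₆ y₅ y₆ z₆
    (T 0 0 = 0 ∧ T 0 1 = 0 ∧ T 0 2 = 0 ∧ T 0 3 = 0 ∧ T 0 4 = prm3 0 0 0 0 0 (a₅ + b₆) (a₆ + d₆) ∧
      T 0 5 = 0 ∧ T 0 6 = 0) ∧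
    (T 1 0 = 0 ∧ T 1 1 = 0 ∧ T 1 2 = 0 ∧ T 1 3 = 0 ∧ T 1 4 = 0 ∧
      T 1 5 = prm3 (t 2) (t 3) (-t 1) (-t 2) 0 a₅ a₆ ∧
      T 1 6 = prm3 (-t 1) (-t 2) (t 0) (t 1) 0 a₆ c₆) ∧
    (T 2 0 = 0 ∧ T 2 1 = 0 ∧ T 2 2 = 0 ∧ T 2 3 = 0 ∧ T 2 4 = 0 ∧
      T 2 5 = prm3 (t 3) (t 4) (-t 2) (-t 3) 0 b₅ b₆ ∧
      T 2 6 = prm3 (-t 2) (-t 3) (t 1) (t 2) 0 b₆ d₆) ∧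
    (T 3 0 = 0 ∧ T 3 1 = 0 ∧ T 3 2 = 0 ∧ T 3 3 = 0 ∧ T 3 4 = prm3 0 0 0 0 0 (2 * v₅) (2 * v₆) ∧
      T 3 5 = 0 ∧ T 3 6 = 0) ∧
    (T 4 0 = -T 0 4 ∧ T 4 1 = 0 ∧ T 4 2 = 0 ∧ T 4 3 = -T 3 4 ∧ T 4 4 = 0 ∧
      T 4 5 = prm3 a₅ b₅ a₆ b₆ v₅ y₅ y₆ ∧ T 4 6 = prm3 a₆ b₆ c₆ d₆ v₆ y₆ z₆) ∧
    (T 5 0 = 0 ∧ T 5 1 = -T 1 5 ∧ T 5 2 = -T 2 5 ∧ T 5 3 = 0 ∧ T 5 4 = -T 4 5 ∧ T 5 5 = 0 ∧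
      T 5 6 = prm3 0 0 0 0 0 (-v₅) (-v₆)) ∧
    (T 6 0 = 0 ∧ T 6 1 = -T 1 6 ∧ T 6 2 = -T 2 6 ∧ T 6 3 = 0 ∧ T 6 4 = -T 4 6 ∧ T 6 5 = -T 5 6 ∧
      T 6 6 = 0) := by
  refine ⟨⟨?_, ?_, ?_, ?_, ?_, ?_, ?_⟩, ⟨?_, ?_, ?_, ?_, ?_, ?_, ?_⟩, ⟨?_, ?_, ?_, ?_, ?_, ?_, ?_⟩,
    ⟨?_, ?_, ?_, ?_, ?_, ?_, ?_⟩, ⟨?_, ?_, ?_, ?_, ?_, ?_, ?_⟩, ⟨?_, ?_, ?_, ?_, ?_, ?_, ?_⟩,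
    ?_, ?_, ?_, ?_, ?_, ?_, ?_⟩ <;> rfl

theorem tab_skew (t : Fin 5 → K) (a₅ b₅ a₆ b₆ c₆ d₆ v₅ v₆ y₅ y₆ z₆ : K) : ∀ i j,
    tab t a₅ b₅ a₆ b₆ c₆ d₆ v₅ v₆ y₅ y₆ z₆ j i = -tab t a₅ b₅ a₆ b₆ c₆ d₆ v₅ v₆ y₅ y₆ z₆ i j := by
  simp [Fin.forall_fin_succ, tab]

theorem mem_pairs : ∀ {i j : Fin 7}, i < j → (i, j) ∈ pairs := by
  decide

set_option maxHeartbeats 4000000 in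
theorem CurvSys.eq_tab [CharZero K] {w : Fin 7 → Prm K} {ρ : Fin 7 → Fin 7 → Prm K}
    (h : CurvSys w ρ) (hu : ∀ i j, ρ i j 7 = 0) (hu' : ∀ i j, ρ i j 8 = 0) :
    ρ = tab ![ρ 1 6 2, ρ 1 6 3, ρ 1 5 0, ρ 1 5 1, ρ 2 5 1] (ρ 4 5 0) (ρ 4 5 1) (ρ 4 6 0) (ρ 4 6 1)
      (ρ 4 6 2) (ρ 4 6 3) (ρ 4 5 4) (ρ 4 6 4) (ρ 4 5 5) (ρ 4 6 5) (ρ 4 6 6) := by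
  have h1 : ∀ x ∈ triples, ∀ l, hm (ρ x.1 x.2.1) l x.2.2 + hm (ρ x.2.1 x.2.2) l x.1
     - hm (ρ x.1 x.2.2) l x.2.1 = 0 := fun x _ => h.first _ _ _
  simp only [triples_eq, List.forall_mem_cons] at h1
  simp [Fin.forall_fin_succ, hm, hu, hu'] at h1
  have h2 : ∀ x ∈ pairs, ρ x.1 x.2 = tab ![ρ 1 6 2, ρ 1 6 3, ρ 1 5 0, ρ 1 5 1, ρ 2 5 1] (ρ 4 5 0)
      (ρ 4 5 1) (ρ 4 6 0) (ρ 4 6 1) (ρ 4 6 2) (ρ 4 6 3) (ρ 4 5 4) (ρ 4 6 4) (ρ 4 5 5) (ρ 4 6 5)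
      (ρ 4 6 6) x.1 x.2 := by
    simp only [pairs, List.forall_mem_cons, funext_iff]
    simp [Fin.forall_fin_succ, tab, prm3, hu, hu']
    grind
  clear h1
  ext1 i
  ext1 j
  rcases lt_trichotomy i j with hij | rfl | hij
  · exact h2 _ (mem_pairs hij)
  · funext m
    rw [self_eq_neg.mp (congrFun (h.skew i i) m), self_eq_neg.mp (congrFun
      (tab_skew _ _ _ _ _ _ _ _ _ _ _ _ i i) m)]
  · rw [h.skew j i, tab_skew _ _ _ _ _ _ _ _ _ _ _ _ j i]
    exact congrArg _ (h2 _ (mem_pairs hij))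

/-- The parameters of `h(diag(a, d), v, (0, u), y)`. -/
def prmu (a d v y z u : K) : Prm K :=
  ![a, 0, 0, d, v, y, z, 0, u]

theorem prmu_apply (a d v y z u : K) :
    prmu a d v y z u 0 = a ∧ prmu a d v y z u 1 = 0 ∧ prmu a d v y z u 2 = 0 ∧
    prmu a d v y z u 3 = d ∧ prmu a d v y z u 4 = v ∧ prmu a d v y z u 5 = y ∧
    prmu a d v y z u 6 = z ∧ prmu a d v y z u 7 = 0 ∧ prmu a d v y z u 8 = u :=
  ⟨rfl, rfl, rfl, rfl, rfl, rfl, rfl, rfl, rfl⟩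

end Model

section Connection

/-- The torsion-free bracket `L(x)y - L(y)x`. -/
def tb (L : V7 →ₗ[ℝ] M7) (x y : V7) : V7 := L x *ᵥ y - L y *ᵥ x

/-- The Jacobi identity for the torsion-free bracket. -/
def Jac (L : V7 →ₗ[ℝ] M7) : Prop :=
  ∀ x y z, tb L (tb L x y) z + tb L (tb L y z) x + tb L (tb L z x) y = 0

variable {L : V7 →ₗ[ℝ] M7}

theorem curv_mem_infHol (bk : V7 → V7 → V7) (x y : V7) : curv L bk x y ∈ infHol L bk :=
  Submodule.mem_sInf.2 fun _ h => h.1 x y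

theorem lie_mem_infHol {bk : V7 → V7 → V7} (z : V7) {X : M7} (hX : X ∈ infHol L bk) :
    L z * X - X * L z ∈ infHol L bk :=
  Submodule.mem_sInf.2 fun _ h => h.2 z X (Submodule.mem_sInf.1 hX _ h)

theorem infHol_le {bk : V7 → V7 → V7} {H : Submodule ℝ M7} (h₁ : ∀ x y, curv L bk x y ∈ H)
    (h₂ : ∀ z, ∀ X ∈ H, L z * X - X * L z ∈ H) : infHol L bk ≤ H :=
  sInf_le ⟨h₁, h₂⟩

/-- The first Bianchi identity. -/
theorem Jac.first (hJ : Jac L) (x y z : V7) :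
    curv L (tb L) x y *ᵥ z + curv L (tb L) y z *ᵥ x + curv L (tb L) z x *ᵥ y = 0 := by
  have h := hJ x y z
  have key : ∀ x y z, curv L (tb L) x y *ᵥ z =
      L x *ᵥ (L y *ᵥ z) - L y *ᵥ (L x *ᵥ z) - tb L (tb L x y) z - L z *ᵥ tb L x y := by
    intro x y z
    simp only [curv, Matrix.sub_mulVec, ← Matrix.mulVec_mulVec]
    rw [tb.eq_def L (tb L x y) z]
    abel
  rw [key, key, key]
  simp only [tb.eq_def L x y, tb.eq_def L y z, tb.eq_def L z x, Matrix.mulVec_sub] at h ⊢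
  rw [← neg_eq_zero, ← h]
  abel

/-- The second Bianchi identity. -/
theorem Jac.second (hJ : Jac L) (x y z : V7) :
    (L x * curv L (tb L) y z - curv L (tb L) y z * L x - curv L (tb L) (tb L x y) z) +
    (L y * curv L (tb L) z x - curv L (tb L) z x * L y - curv L (tb L) (tb L y z) x) +
    (L z * curv L (tb L) x y - curv L (tb L) x y * L z - curv L (tb L) (tb L z x) y) = 0 := by
  have h := congrArg L (hJ x y z)
  simp only [map_add, map_zero] at h
  rw [← h]
  simp only [curv]
  noncomm_ring

/-- The connection transported along the linear map `G` with inverse `G'`. -/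
def conjMap (G G' : M7) (L : V7 →ₗ[ℝ] M7) : V7 →ₗ[ℝ] M7 where
  toFun x := G * L (G' *ᵥ x) * G'
  map_add' x y := by rw [Matrix.mulVec_add, map_add, mul_add, add_mul]
  map_smul' r x := by simp [Matrix.mulVec_smul]

theorem conjMap_apply (G G' : M7) (L : V7 →ₗ[ℝ] M7) (x : V7) :
    conjMap G G' L x = G * L (G' *ᵥ x) * G' := rfl

variable {G G' : M7}

theorem tb_conj (x y : V7) :
    tb (conjMap G G' L) x y = G *ᵥ tb L (G' *ᵥ x) (G' *ᵥ y) := by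
  simp only [tb, conjMap_apply, Matrix.mulVec_sub, ← Matrix.mulVec_mulVec]

theorem curv_conj (hG : G' * G = 1) (x y : V7) :
    curv (conjMap G G' L) (tb (conjMap G G' L)) x y =
      G * curv L (tb L) (G' *ᵥ x) (G' *ᵥ y) * G' := by
  have key : ∀ A B : M7, G * A * G' * (G * B * G') = G * (A * B) * G' := fun A B => by
    rw [show G * A * G' * (G * B * G') = G * A * (G' * G) * B * G' by noncomm_ring, hG]
    noncomm_ring
  simp only [curv, tb_conj]
  simp only [conjMap_apply, key, Matrix.mulVec_mulVec, ← mul_assoc, hG, Matrix.one_mulVec]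
  noncomm_ring

theorem Jac.conj (hJ : Jac L) (hG : G' * G = 1) : Jac (conjMap G G' L) := by
  intro x y z
  simp only [tb_conj, Matrix.mulVec_mulVec, hG, Matrix.one_mulVec, ← Matrix.mulVec_add]
  rw [hJ, Matrix.mulVec_zero]

theorem conj_mem_infHol (hG : G' * G = 1) {X : M7}
    (hX : X ∈ infHol L (tb L)) :
    G * X * G' ∈ infHol (conjMap G G' L) (tb (conjMap G G' L)) := by
  let f : M7 →ₗ[ℝ] M7 := (LinearMap.mulLeft ℝ G).comp (LinearMap.mulRight ℝ G')
  have hf : ∀ X, f X = G * X * G' := fun X => (mul_assoc _ _ _).symm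
  have : infHol L (tb L) ≤ (infHol (conjMap G G' L) (tb (conjMap G G' L))).comap f := by
    refine infHol_le (fun x y => ?_) fun z X hX => ?_
    · have := curv_mem_infHol (L := conjMap G G' L) (tb (conjMap G G' L)) (G *ᵥ x) (G *ᵥ y)
      rwa [curv_conj hG, Matrix.mulVec_mulVec, Matrix.mulVec_mulVec, hG, Matrix.one_mulVec,
        Matrix.one_mulVec, ← hf] at this
    · have := lie_mem_infHol (L := conjMap G G' L) (G *ᵥ z) hX
      rw [conjMap_apply, Matrix.mulVec_mulVec, hG, Matrix.one_mulVec, hf] at this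
      rw [Submodule.mem_comap, hf]
      convert this using 1
      rw [show G * L z * G' * (G * X * G') = G * L z * (G' * G) * X * G' by noncomm_ring,
        show G * X * G' * (G * L z * G') = G * X * (G' * G) * L z * G' by noncomm_ring, hG]
      noncomm_ring
  have h := this hX
  rwa [Submodule.mem_comap, hf] at h

end Connection

/-- The parameters of a matrix in `𝔥^I`, as a linear map on all matrices. -/
def prm : M7 →ₗ[ℝ] Prm ℝ where
  toFun X := ![X 1 1, X 1 2, X 2 1, X 2 2, X 3 4, X 1 4, X 2 4, X 3 5, X 3 6]
  map_add' X Y := by ext i; fin_cases i <;> simp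
  map_smul' r X := by ext i; fin_cases i <;> simp

theorem prm_hm (p : Prm ℝ) : prm (hm p) = p := by
  ext i; fin_cases i <;> simp [prm, hm]

/-- `hm` as a linear map. -/
def hmL : Prm ℝ →ₗ[ℝ] M7 where
  toFun := hm
  map_add' p q := by
    ext i j
    revert i j
    simp only [Fin.forall_fin_succ, hm]
    simp
    grind
  map_smul' r p := by
    ext i j
    revert i j
    simp only [Fin.forall_fin_succ, hm]
    simp
    grind

theorem hmL_apply (p : Prm ℝ) : hmL p = hm p := rfl

theorem hm_br (p q : Prm ℝ) : hm p * hm q - hm q * hm p = hm (br p q) := by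
  ext i j
  revert i j
  simp only [Fin.forall_fin_succ, hm, br, Matrix.mul_apply, Matrix.sub_apply, Fin.sum_univ_succ]
  simp
  grind

section System

variable {L : V7 →ₗ[ℝ] M7} {w : Fin 7 → Prm ℝ}

/-- The curvature parameters. -/
def rho (L : V7 →ₗ[ℝ] M7) (i j : Fin 7) : Prm ℝ := prm (curv L (tb L) (e i) (e j))

theorem tb_basis (hw : ∀ i, L (e i) = hm (w i)) (i j : Fin 7) :
    tb L (e i) (e j) = ∑ k, tor w i j k • e k := by
  rw [tb, hw, hw]
  ext l
  simp [e, tor, Matrix.col_apply, Finset.sum_apply,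
    Pi.single_apply]

theorem curv_tb_swap (x y : V7) : curv L (tb L) y x = -curv L (tb L) x y := by
  have : tb L y x = -tb L x y := by simp [tb]
  simp only [curv, this, map_neg]
  abel

theorem curv_add_left (x x' y : V7) :
    curv L (tb L) (x + x') y = curv L (tb L) x y + curv L (tb L) x' y := by
  simp only [curv, tb, map_add, map_sub, add_mul, mul_add, Matrix.add_mulVec, Matrix.mulVec_add]
  abel

theorem curv_smul_left (r : ℝ) (x y : V7) :
    curv L (tb L) (r • x) y = r • curv L (tb L) x y := by
  simp only [curv, tb, map_smul, map_sub, smul_mul_assoc, mul_smul_comm, Matrix.smul_mulVec,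
    Matrix.mulVec_smul, smul_sub]

/-- The curvature as a linear map in its first argument. -/
def curvL (L : V7 →ₗ[ℝ] M7) (y : V7) : V7 →ₗ[ℝ] M7 where
  toFun x := curv L (tb L) x y
  map_add' x x' := curv_add_left x x' y
  map_smul' r x := curv_smul_left r x y

theorem curvL_apply (x y : V7) : curvL L y x = curv L (tb L) x y := rfl

theorem curv_basis (hw : ∀ i, L (e i) = hm (w i)) (i j : Fin 7) :
    curv L (tb L) (e i) (e j) = hm (rho L i j) ∧
      rho L i j = br (w i) (w j) - ∑ k, tor w i j k • w k := by
  have : curv L (tb L) (e i) (e j) = hm (br (w i) (w j) - ∑ k, tor w i j k • w k) := by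
    rw [curv, tb_basis hw, hw, hw, hm_br, map_sum]
    simp only [map_smul, hw, ← hmL_apply, map_sub, map_sum]
  rw [rho, this, prm_hm]
  exact ⟨rfl, rfl⟩

theorem Jac.curvSys (hJ : Jac L) (hw : ∀ i, L (e i) = hm (w i)) : CurvSys w (rho L) where
  skew i j := by rw [rho, curv_tb_swap, map_neg, rho]
  def_eq i j m := by simp [(curv_basis hw i j).2]
  first i j k l := by
    have h := congrFun (hJ.first (e i) (e j) (e k)) l
    rw [curv_tb_swap (e i) (e k), (curv_basis hw i j).1, (curv_basis hw j k).1,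
      (curv_basis hw i k).1] at h
    simpa [e, Matrix.mulVec_single_one, Matrix.neg_mulVec, Matrix.col_apply, sub_eq_add_neg] using h
  second i j k m := by
    have h := hJ.second (e i) (e j) (e k)
    have key : ∀ i j k, L (e i) * curv L (tb L) (e j) (e k) - curv L (tb L) (e j) (e k) * L (e i) -
        curv L (tb L) (tb L (e i) (e j)) (e k) =
        hm (br (w i) (rho L j k) - ∑ l, tor w i j l • rho L l k) := by
      intro i j k
      rw [(curv_basis hw j k).1, hw, hm_br, tb_basis hw, ← curvL_apply, map_sum]
      simp only [map_smul, curvL_apply, fun l => (curv_basis hw l k).1, ← hmL_apply, map_sub,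
        map_sum]
    rw [key, key, key] at h
    have h' := congrFun (congrArg prm h) m
    have h1 : rho L k i = -rho L i k := by rw [rho, curv_tb_swap, map_neg, rho]
    have h2 : ∀ l, tor w k i l = -tor w i k l := fun l => by simp [tor]
    have h3 : br (w j) (-rho L i k) = -br (w j) (rho L i k) := by
      ext m; fin_cases m <;> simp [br] <;> ring
    simp only [map_add, prm_hm, map_zero, h1, h2, h3] at h'
    simp at h'
    linear_combination h'

end System

section Holonomy

variable {L : V7 →ₗ[ℝ] M7} {w : Fin 7 → Prm ℝ}

theorem basis_sum (x : V7) : x = ∑ i, x i • e i := by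
  ext j
  simp [e, Finset.sum_apply, Pi.single_apply]

theorem apply_eq_hm (hw : ∀ i, L (e i) = hm (w i)) (z : V7) : L z = hm (∑ i, z i • w i) := by
  conv_lhs => rw [basis_sum z]
  rw [← hmL_apply, map_sum, map_sum]
  simp only [map_smul, hw, hmL_apply]

/-- A bracket-stable space of parameters containing the curvature contains the holonomy. -/
theorem infHol_le_map (hw : ∀ i, L (e i) = hm (w i)) {S : Submodule ℝ (Prm ℝ)}
    (h₁ : ∀ i j, rho L i j ∈ S) (h₂ : ∀ i, ∀ p ∈ S, br (w i) p ∈ S) :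
    infHol L (tb L) ≤ S.map hmL := by
  have hb : ∀ (x : V7) (p : Prm ℝ), hm (br (∑ i, x i • w i) p) = ∑ i, x i • hm (br (w i) p) := by
    intro x p
    simp only [← hm_br, ← apply_eq_hm hw, ← hw]
    conv_lhs => rw [basis_sum x]
    simp only [map_sum, map_smul, Finset.sum_mul, Finset.mul_sum, ← Finset.sum_sub_distrib,
      smul_sub, smul_mul_assoc, mul_smul_comm]
  refine infHol_le (fun x y => ?_) fun z X hX => ?_
  · rw [← curvL_apply, basis_sum x, map_sum]
    refine Submodule.sum_mem _ fun i _ => ?_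
    rw [map_smul, curvL_apply, curv_tb_swap, ← curvL_apply, basis_sum y, map_sum]
    refine Submodule.smul_mem _ _ (Submodule.neg_mem _ (Submodule.sum_mem _ fun j _ => ?_))
    rw [map_smul, curvL_apply, (curv_basis hw j i).1]
    exact Submodule.smul_mem _ _ ⟨_, h₁ j i, rfl⟩
  · obtain ⟨p, hp, rfl⟩ := hX
    rw [apply_eq_hm hw, hmL_apply, hm_br, hb]
    exact Submodule.sum_mem _ fun i _ => Submodule.smul_mem _ _ ⟨_, h₂ i p hp, rfl⟩

theorem mem_of_hm_mem (hw : ∀ i, L (e i) = hm (w i)) {S : Submodule ℝ (Prm ℝ)}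
    (h₁ : ∀ i j, rho L i j ∈ S) (h₂ : ∀ i, ∀ p ∈ S, br (w i) p ∈ S) {p : Prm ℝ}
    (hp : hm p ∈ infHol L (tb L)) : p ∈ S := by
  obtain ⟨q, hq, h⟩ := infHol_le_map hw h₁ h₂ hp
  have := congrArg prm h
  rw [hmL_apply, prm_hm, prm_hm] at this
  exact this ▸ hq

/-- The space of parameters with vanishing trace and `u = 0`. -/
def sTr : Submodule ℝ (Prm ℝ) where
  carrier := {p | p 0 + p 3 = 0 ∧ p 7 = 0 ∧ p 8 = 0}
  add_mem' := by rintro p q ⟨h1, h2, h3⟩ ⟨h4, h5, h6⟩; simp; grind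
  zero_mem' := by simp
  smul_mem' := by rintro r p ⟨h1, h2, h3⟩; simp; grind

/-- The space of parameters with vanishing trace, `v = 0` and `u = 0`. -/
def sV : Submodule ℝ (Prm ℝ) where
  carrier := {p | p 0 + p 3 = 0 ∧ p 4 = 0 ∧ p 7 = 0 ∧ p 8 = 0}
  add_mem' := by rintro p q ⟨h1, h2, h3, h⟩ ⟨h4, h5, h6, h'⟩; simp; grind
  zero_mem' := by simp
  smul_mem' := by rintro r p ⟨h1, h2, h3, h⟩; simp; grind

/-- The space of parameters with `A = 0` and `u = 0`. -/
def sA : Submodule ℝ (Prm ℝ) where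
  carrier := {p | p 0 = 0 ∧ p 1 = 0 ∧ p 2 = 0 ∧ p 3 = 0 ∧ p 7 = 0 ∧ p 8 = 0}
  add_mem' := by
    rintro p q ⟨h1, h2, h3, h4, h5, h6⟩ ⟨h7, h8, h9, h10, h11, h12⟩
    simp [h1, h2, h3, h4, h5, h6, h7, h8, h9, h10, h11, h12]
  zero_mem' := by simp
  smul_mem' := by rintro r p ⟨h1, h2, h3, h4, h5, h6⟩; simp [h1, h2, h3, h4, h5, h6]

/-- The space of parameters with `A` upper triangular of vanishing trace and `u = 0`. -/
def sC : Submodule ℝ (Prm ℝ) where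
  carrier := {p | p 0 + p 3 = 0 ∧ p 2 = 0 ∧ p 7 = 0 ∧ p 8 = 0}
  add_mem' := by rintro p q ⟨h1, h2, h3, h⟩ ⟨h4, h5, h6, h'⟩; simp; grind
  zero_mem' := by simp
  smul_mem' := by rintro r p ⟨h1, h2, h3, h⟩; simp; grind

theorem br_mem_sTr {q p : Prm ℝ} (h : q 7 = 0) (h' : q 8 = 0) (hp : p ∈ sTr) : br q p ∈ sTr := by
  obtain ⟨h1, h2, h3⟩ := hp
  refine ⟨?_, ?_, ?_⟩ <;> simp only [br_apply] <;> grind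

theorem br_mem_sV {q p : Prm ℝ} (h : q 7 = 0) (h' : q 8 = 0) (hp : p ∈ sV) : br q p ∈ sV := by
  obtain ⟨h1, h2, h3, h4⟩ := hp
  refine ⟨?_, ?_, ?_, ?_⟩ <;> simp only [br_apply] <;> grind

theorem br_mem_sA {q p : Prm ℝ} (hp : p ∈ sA) : br q p ∈ sA := by
  obtain ⟨h1, h2, h3, h4, h5, h6⟩ := hp
  refine ⟨?_, ?_, ?_, ?_, ?_, ?_⟩ <;> simp only [br_apply] <;> grind

theorem br_mem_sC {q p : Prm ℝ} (hc : q 2 = 0) (h : q 7 = 0) (h' : q 8 = 0) (hp : p ∈ sC) :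
    br q p ∈ sC := by
  obtain ⟨h1, h2, h3, h4⟩ := hp
  refine ⟨?_, ?_, ?_, ?_⟩ <;> simp only [br_apply] <;> grind

end Holonomy

section Normalize

/-- The block matrix `diag(1, P, 1, 1, P⁻ᵀ)` for `P = (p, q; r, s)` of determinant one. -/
def gm (p q r s : ℝ) : M7 :=
  !![1, 0, 0, 0, 0, 0, 0;
     0, p, q, 0, 0, 0, 0;
     0, r, s, 0, 0, 0, 0;
     0, 0, 0, 1, 0, 0, 0;
     0, 0, 0, 0, 1, 0, 0;
     0, 0, 0, 0, 0, s, -r;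
     0, 0, 0, 0, 0, -q, p]

theorem gm_mul_inv {p q r s : ℝ} (h : p * s - q * r = 1) : gm p q r s * gm s (-q) (-r) p = 1 := by
  ext i j
  revert i j
  simp only [Fin.forall_fin_succ, gm, Matrix.mul_apply, Fin.sum_univ_succ]
  simp
  grind

/-- The conjugate of `h(A, v, y)` by `gm p q r s`, in terms of parameters. -/
def gact (p q r s : ℝ) (x : Prm ℝ) : Prm ℝ :=
  prm3 (p * x 0 * s + q * x 2 * s - p * x 1 * r - q * x 3 * r)
    (-(p * x 0 * q) - q * x 2 * q + p * x 1 * p + q * x 3 * p)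
    (r * x 0 * s + s * x 2 * s - r * x 1 * r - s * x 3 * r)
    (-(r * x 0 * q) - s * x 2 * q + r * x 1 * p + s * x 3 * p)
    (x 4) (p * x 5 + q * x 6) (r * x 5 + s * x 6)

theorem gm_conj {p q r s : ℝ} (h : p * s - q * r = 1) {x : Prm ℝ} (h7 : x 7 = 0) (h8 : x 8 = 0) :
    gm p q r s * hm x * gm s (-q) (-r) p = hm (gact p q r s x) := by
  ext i j
  revert i j
  simp only [Fin.forall_fin_succ, gm, gact, prm3, hm, Matrix.mul_apply, Fin.sum_univ_succ]
  simp [h7, h8]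
  grind

variable {L : V7 →ₗ[ℝ] M7} {w : Fin 7 → Prm ℝ}

/-- A torsion-free connection with values in `𝔥^III`. -/
structure Adapted (L : V7 →ₗ[ℝ] M7) : Prop where
  jac : Jac L
  mem : ∀ x, L x = hm (prm (L x)) ∧ prm (L x) 7 = 0 ∧ prm (L x) 8 = 0

theorem Adapted.conj (hL : Adapted L) {p q r s : ℝ} (h : p * s - q * r = 1) :
    Adapted (conjMap (gm p q r s) (gm s (-q) (-r) p) L) where
  jac := hL.jac.conj (by simpa [mul_comm] using gm_mul_inv (p := s) (s := p) (q := -q) (r := -r) (by linarith))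
  mem x := by
    obtain ⟨h1, h2, h3⟩ := hL.mem (gm s (-q) (-r) p *ᵥ x)
    rw [conjMap_apply, h1, gm_conj h h2 h3, prm_hm]
    exact ⟨rfl, rfl, rfl⟩

theorem Adapted.rho_eq_zero (hL : Adapted L) (i j : Fin 7) : rho L i j 7 = 0 ∧ rho L i j 8 = 0 := by
  rw [(curv_basis (fun i => (hL.mem (e i)).1) i j).2]
  simp [(hL.mem _).2, br_apply]

theorem Adapted.rho_conj (hL : Adapted L) {p q r s : ℝ} (h : p * s - q * r = 1) :
    rho (conjMap (gm p q r s) (gm s (-q) (-r) p) L) 4 5 =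
      gact p q r s (p • rho L 4 5 + q • rho L 4 6) ∧
    rho (conjMap (gm p q r s) (gm s (-q) (-r) p) L) 4 6 =
      gact p q r s (r • rho L 4 5 + s • rho L 4 6) := by
  have hG : gm s (-q) (-r) p * gm p q r s = 1 := by
    simpa using gm_mul_inv (p := s) (s := p) (q := -q) (r := -r) (by linarith)
  have h4 : gm s (-q) (-r) p *ᵥ e 4 = e 4 := by
    ext i; fin_cases i <;> simp [gm, e]
  have h5 : gm s (-q) (-r) p *ᵥ e 5 = p • e 5 + q • e 6 := by
    ext i; fin_cases i <;> simp [gm, e]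
  have h6 : gm s (-q) (-r) p *ᵥ e 6 = r • e 5 + s • e 6 := by
    ext i; fin_cases i <;> simp [gm, e]
  have key : ∀ a b : ℝ, curv L (tb L) (e 4) (a • e 5 + b • e 6) =
      hm (a • rho L 4 5 + b • rho L 4 6) := by
    intro a b
    rw [curv_tb_swap, ← curvL_apply, map_add, map_smul, map_smul, curvL_apply, curvL_apply,
      curv_tb_swap (e 4), curv_tb_swap (e 4), (curv_basis (fun i => (hL.mem (e i)).1) 4 5).1,
      (curv_basis (fun i => (hL.mem (e i)).1) 4 6).1]
    simp only [← hmL_apply, map_add, map_smul]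
    module
  constructor
  · rw [rho, curv_conj hG, h4, h5, key, gm_conj h _ _, prm_hm] <;> simp [hL.rho_eq_zero]
  · rw [rho, curv_conj hG, h4, h6, key, gm_conj h _ _, prm_hm] <;> simp [hL.rho_eq_zero]

/-- A nonzero pair can be moved to `(1, 0)` by `SL(2, ℝ)`. -/
theorem exists_sl2 {x y : ℝ} (h : x ≠ 0 ∨ y ≠ 0) :
    ∃ p q r s : ℝ, p * s - q * r = 1 ∧ p * x + q * y = 1 ∧ r * x + s * y = 0 := by
  have hN : x ^ 2 + y ^ 2 ≠ 0 := by
    rcases h with h | h <;> positivity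
  refine ⟨x / (x ^ 2 + y ^ 2), y / (x ^ 2 + y ^ 2), -y, x, ?_, ?_, ?_⟩ <;> field_simp <;> ring

end Normalize

set_option maxHeartbeats 1000000 in
theorem CurvSys.eq_zero_of_diag {K : Type*} [Field K] [CharZero K] {a d v y z u : Fin 7 → K}
    {p v₅ v₆ y₅ y₆ z₆ : K}
    (h : CurvSys (fun i => prmu (a i) (d i) (v i) (y i) (z i) (u i))
      (tab 0 p 0 0 0 0 0 v₅ v₆ y₅ y₆ z₆)) : p = 0 := by
  by_contra hp
  have s0450 := h.second 0 4 5 0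
  have s1450 := h.second 1 4 5 0
  have s2450 := h.second 2 4 5 0
  have s3450 := h.second 3 4 5 0
  have s4560 := h.second 4 5 6 0
  have e050 := h.def_eq 0 5 0
  have e450 := h.def_eq 4 5 0
  have s0455 := h.second 0 4 5 5
  have e045 := h.def_eq 0 4 5
  have s1455 := h.second 1 4 5 5
  have e155 := h.def_eq 1 5 5
  have s2455 := h.second 2 4 5 5
  have e255 := h.def_eq 2 5 5
  have e020 := h.def_eq 0 2 0
  have e453 := h.def_eq 4 5 3
  have s2454 := h.second 2 4 5 4
  have e150 := h.def_eq 1 5 0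
  have e140 := h.def_eq 1 4 0
  have e153 := h.def_eq 1 5 3
  have e143 := h.def_eq 1 4 3
  have s0454 := h.second 0 4 5 4
  have e053 := h.def_eq 0 5 3
  have e015 := h.def_eq 0 1 5
  simp only [Fin.sum_univ_seven, tor, hm_apply, br_apply, tab_apply, prm3_apply, prmu_apply,
    Pi.neg_apply, Pi.zero_apply, mul_zero, zero_mul, add_zero,
    zero_add, sub_zero, zero_sub, neg_zero, sub_self, neg_neg] at s0450 s1450 s2450 s3450 s4560 e050 e450 s0455 e045 s1455 e155 s2455 e255 e020 e453 s2454 e150 e140 e153 e143 s0454 e053 e015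
  have d0 : d 0 = -2 * a 0 := by clear * - hp s0450; grind (ringSteps := 300000)
  have d1 : d 1 = -2 * a 1 := by clear * - hp d0 s1450; grind (ringSteps := 300000)
  have d2 : d 2 = -2 * a 2 := by clear * - hp d0 d1 s2450; grind (ringSteps := 300000)
  have d3 : d 3 = -2 * a 3 := by clear * - hp d0 d1 d2 s3450; grind (ringSteps := 300000)
  have d6 : d 6 = -2 * a 6 := by clear * - hp d0 d1 d2 d3 s4560; grind (ringSteps := 300000)
  have a2 : a 2 = 0 := by
    clear * - hp d0 d1 d2 d3 d6 e050 e450 s0455 e045 s1455 e155 s2455 e255 e020 e453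
    grind (ringSteps := 300000)
  have v2 : v 2 = 0 := by clear * - hp d0 d1 d2 d3 d6 a2 s2454; grind (ringSteps := 300000)
  have y2 : y 2 = 0 := by clear * - hp d0 d1 d2 d3 d6 a2 v2 s2455; grind (ringSteps := 300000)
  have a1 : a 1 = 0 := by
    clear * - hp d0 d1 d2 d3 d6 a2 v2 y2 e150 e450 e140 e153 e143 e453
    grind (ringSteps := 300000)
  clear * - hp d0 d1 d2 d3 d6 a2 v2 y2 a1 s0454 s0455 e053 e045 s1455 e015 e450 e453 e155
  grind (ringSteps := 300000)

section Trace

variable {K : Type*} [Field K] [CharZero K] {a b c d v y z : Fin 7 → K} {t : Fin 5 → K}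
  {b₅ b₆ a₆ c₆ v₅ v₆ y₅ y₆ z₆ : K}

set_option maxHeartbeats 1000000 in
theorem CurvSys.linear_of_trace
    (h : CurvSys (fun i => prm3 (a i) (b i) (c i) (d i) (v i) (y i) (z i))
      (tab t (1 - b₆) b₅ a₆ b₆ c₆ (-a₆) v₅ v₆ y₅ y₆ z₆)) :
    c 0 = 0 ∧ c 1 = 0 ∧ c 2 = 0 ∧ c 3 = 0 ∧ d 0 = -2 * a 0 ∧ d 1 = -2 * a 1 ∧
      d 2 = -2 * a 2 ∧ d 3 = -2 * a 3 ∧ c 5 = 2 * a 6 + d 6 := by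
  have T046 := congrArg₂ (· + ·) (h.second 0 4 6 0) (h.second 0 4 6 3)
  have T146 := congrArg₂ (· + ·) (h.second 1 4 6 0) (h.second 1 4 6 3)
  have T246 := congrArg₂ (· + ·) (h.second 2 4 6 0) (h.second 2 4 6 3)
  have T346 := congrArg₂ (· + ·) (h.second 3 4 6 0) (h.second 3 4 6 3)
  have T045 := congrArg₂ (· + ·) (h.second 0 4 5 0) (h.second 0 4 5 3)
  have T145 := congrArg₂ (· + ·) (h.second 1 4 5 0) (h.second 1 4 5 3)
  have T245 := congrArg₂ (· + ·) (h.second 2 4 5 0) (h.second 2 4 5 3)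
  have T345 := congrArg₂ (· + ·) (h.second 3 4 5 0) (h.second 3 4 5 3)
  have T456 := congrArg₂ (· + ·) (h.second 4 5 6 0) (h.second 4 5 6 3)
  simp only [Fin.sum_univ_seven, tor, hm_apply, br_apply, tab_apply, prm3_apply, Pi.neg_apply,
    Pi.zero_apply, sub_add_cancel, add_neg_cancel, mul_zero, add_zero, zero_add,
    sub_zero, zero_sub, neg_zero, sub_self, neg_neg] at T046 T146 T246 T346 T045 T145 T245 T345 T456
  refine ⟨?_, ?_, ?_, ?_, ?_, ?_, ?_, ?_, ?_⟩
  · clear * - T046; grind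
  · clear * - T146; grind
  · clear * - T246; grind
  · clear * - T346; grind
  · clear * - T045; grind
  · clear * - T145; grind
  · clear * - T245; grind
  · clear * - T345; grind
  · clear * - T456; grind

set_option maxHeartbeats 1000000 in
theorem CurvSys.t_zero_of_trace
    (h : CurvSys (fun i => prm3 (a i) (b i) (c i) (d i) (v i) (y i) (z i))
      (tab t (1 - b₆) b₅ a₆ b₆ c₆ (-a₆) v₅ v₆ y₅ y₆ z₆)) :
    t 0 = 0 := by
  obtain ⟨c0, c1, c2, c3, d0, d1, d2, d3, c5⟩ := h.linear_of_trace
  by_contra t0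
  have s0160 := h.second 0 1 6 0
  have s0162 := h.second 0 1 6 2
  have s1360 := h.second 1 3 6 0
  have s1362 := h.second 1 3 6 2
  have e162 := h.def_eq 1 6 2
  have e060 := h.def_eq 0 6 0
  have e360 := h.def_eq 3 6 0
  have e142 := h.def_eq 1 4 2
  have e450 := h.def_eq 4 5 0
  have e453 := h.def_eq 4 5 3
  have e150 := h.def_eq 1 5 0
  have e153 := h.def_eq 1 5 3
  have e461 := h.def_eq 4 6 1
  have e463 := h.def_eq 4 6 3
  have e160 := h.def_eq 1 6 0
  have e161 := h.def_eq 1 6 1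
  have e141 := h.def_eq 1 4 1
  have e143 := h.def_eq 1 4 3
  have e152 := h.def_eq 1 5 2
  have e452 := h.def_eq 4 5 2
  have e121 := h.def_eq 1 2 1
  have e120 := h.def_eq 1 2 0
  have e140 := h.def_eq 1 4 0
  simp only [Fin.sum_univ_seven, tor, hm_apply, br_apply, tab_apply, prm3_apply, Pi.neg_apply,
    Pi.zero_apply, sub_add_cancel, add_neg_cancel, mul_zero, zero_mul, add_zero, zero_add,
    sub_zero, zero_sub, neg_zero, sub_self, neg_neg, c0, c1, c2, c3, d0, d1, d2, d3, c5] at s0160 s0162 s1360 s1362 e162 e060 e360 e142 e450 e453 e150 e153 e461 e463 e160 e161 e141 e143 e152 e452 e121 e120 e140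
  have b0 : b 0 = 0 := by clear * - t0 s0160 s0162; grind (ringSteps := 300000)
  have a0 : a 0 = 0 := by clear * - t0 b0 s0162; grind (ringSteps := 300000)
  have b3 : b 3 = 0 := by clear * - t0 b0 a0 s1360 s1362; grind (ringSteps := 300000)
  have a3 : a 3 = 0 := by clear * - t0 b0 a0 b3 s1362; grind (ringSteps := 300000)
  have v0 : v 0 = 0 := by clear * - t0 b0 a0 b3 a3 e162 e060; grind (ringSteps := 300000)
  have v3 : v 3 = 0 := by clear * - t0 b0 a0 b3 a3 v0 e162 e360; grind (ringSteps := 300000)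
  have c4 : c 4 = 0 := by clear * - t0 b0 a0 b3 a3 v0 v3 e142 e162; grind (ringSteps := 300000)
  have a1 : a 1 = 0 := by
    clear * - t0 b0 a0 b3 a3 v0 v3 c4 e450 e453 e150 e153 e461 e463 e160 e161 e141 e143 e152 e452
      e121 e120 e140
    grind (ringSteps := 300000)
  clear * - t0 b0 a0 b3 a3 v0 v3 c4 a1 e162
  grind (ringSteps := 300000)

set_option maxHeartbeats 1000000 in
theorem CurvSys.t_of_trace
    (h : CurvSys (fun i => prm3 (a i) (b i) (c i) (d i) (v i) (y i) (z i))
      (tab t (1 - b₆) b₅ a₆ b₆ c₆ (-a₆) v₅ v₆ y₅ y₆ z₆)) :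
    t 0 = 0 ∧ t 1 = 0 ∧ t 2 = 0 ∧ t 3 = 0 := by
  obtain ⟨c0, c1, c2, c3, d0, d1, d2, d3, c5⟩ := h.linear_of_trace
  have t0 := h.t_zero_of_trace
  have e160 := h.def_eq 1 6 0
  have e152 := h.def_eq 1 5 2
  have e262 := h.def_eq 2 6 2
  have s0160 := h.second 0 1 6 0
  have s1262 := h.second 1 2 6 2
  have e150 := h.def_eq 1 5 0
  have e252 := h.def_eq 2 5 2
  have e153 := h.def_eq 1 5 3
  have s1250 := h.second 1 2 5 0
  have s1562 := h.second 1 5 6 2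
  have e121 := h.def_eq 1 2 1
  have e562 := h.def_eq 5 6 2
  have e253 := h.def_eq 2 5 3
  have s0250 := h.second 0 2 5 0
  have s1251 := h.second 1 2 5 1
  have s2560 := h.second 2 5 6 0
  have s1560 := h.second 1 5 6 0
  simp only [Fin.sum_univ_seven, tor, hm_apply, br_apply, tab_apply, prm3_apply, Pi.neg_apply,
    Pi.zero_apply, sub_add_cancel, add_neg_cancel, mul_zero, zero_mul, add_zero, zero_add,
    sub_zero, zero_sub, neg_zero, sub_self, neg_neg, c0, c1, c2, c3, d0, d1, d2, d3, c5, t0] at e160 e152 e262 s0160 s1262 e150 e252 e153 s1250 s1562 e121 e562 e253 s0250 s1251 s2560 s1560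
  have t1 : t 1 = 0 := by clear * - e160 e152 e262 s0160 s1262; grind (ringSteps := 300000)
  have t2 : t 2 = 0 := by clear * - t1 e150 e252 e153 s1250 e152 s1562; grind (ringSteps := 300000)
  have t3 : t 3 = 0 := by
    clear * - t1 t2 e121 e562 e253 s0250 s1251 s1250 s2560 s1560
    grind (ringSteps := 300000)
  exact ⟨t0, t1, t2, t3⟩

set_option maxHeartbeats 1000000 in
theorem CurvSys.c₆_of_trace
    (h : CurvSys (fun i => prm3 (a i) (b i) (c i) (d i) (v i) (y i) (z i))
      (tab t (1 - b₆) b₅ a₆ b₆ c₆ (-a₆) v₅ v₆ y₅ y₆ z₆)) :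
    c₆ = 0 := by
  obtain ⟨c0, c1, c2, c3, d0, d1, d2, d3, c5⟩ := h.linear_of_trace
  obtain ⟨t0, t1, t2, t3⟩ := h.t_of_trace
  by_contra hc
  have s0460 := h.second 0 4 6 0
  have s2560 := h.second 2 5 6 0
  have s0451 := h.second 0 4 5 1
  have s2561 := h.second 2 5 6 1
  have s0462 := h.second 0 4 6 2
  have s1462 := h.second 1 4 6 2
  have s0454 := h.second 0 4 5 4
  have e164 := h.def_eq 1 6 4
  have e166 := h.def_eq 1 6 6
  have s2462 := h.second 2 4 6 2
  have s3462 := h.second 3 4 6 2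
  have s1460 := h.second 1 4 6 0
  have s2460 := h.second 2 4 6 0
  have s3460 := h.second 3 4 6 0
  have s4560 := h.second 4 5 6 0
  have s4562 := h.second 4 5 6 2
  have e452 := h.def_eq 4 5 2
  have e462 := h.def_eq 4 6 2
  have e562 := h.def_eq 5 6 2
  have s0466 := h.second 0 4 6 6
  have e046 := h.def_eq 0 4 6
  have e066 := h.def_eq 0 6 6
  have s1466 := h.second 1 4 6 6
  have s2466 := h.second 2 4 6 6
  have e266 := h.def_eq 2 6 6
  have e560 := h.def_eq 5 6 0
  have e563 := h.def_eq 5 6 3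
  have e450 := h.def_eq 4 5 0
  have e460 := h.def_eq 4 6 0
  have e453 := h.def_eq 4 5 3
  have e463 := h.def_eq 4 6 3
  have s0455 := h.second 0 4 5 5
  have s0465 := h.second 0 4 6 5
  have e045 := h.def_eq 0 4 5
  have e055 := h.def_eq 0 5 5
  have e065 := h.def_eq 0 6 5
  have e056 := h.def_eq 0 5 6
  have s1454 := h.second 1 4 5 4
  have s1455 := h.second 1 4 5 5
  have s1465 := h.second 1 4 6 5
  have e155 := h.def_eq 1 5 5
  have e165 := h.def_eq 1 6 5
  have e156 := h.def_eq 1 5 6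
  have s2454 := h.second 2 4 5 4
  have s2465 := h.second 2 4 6 5
  have e265 := h.def_eq 2 6 5
  have e256 := h.def_eq 2 5 6
  have e461 := h.def_eq 4 6 1
  simp only [Fin.sum_univ_seven, tor, hm_apply, br_apply, tab_apply, prm3_apply, Pi.neg_apply,
    Pi.zero_apply, sub_add_cancel, add_neg_cancel, mul_zero, zero_mul, add_zero, zero_add,
    sub_zero, zero_sub, neg_zero, sub_self, neg_neg, c0, c1, c2, c3, d0, d1, d2, d3, c5, t0, t1,
    t2, t3] at s0460 s2560 s0451 s2561 s0462 s1462 s0454 e164 e166 s2462 s3462 s1460 s2460 s3460 s4560 s4562 e452 e462 e562 s0466 e046 e066 s1466 s2466 e266 e560 e563 e450 e460 e453 e463 s0455 s0465 e045 e055 e065 e056 s1454 s1455 s1465 e155 e165 e156 s2454 s2465 e265 e256 e461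
  have t4 : t 4 = 0 := by
    clear * - hc s0460 s2560 s0451 s2561 s0462 s1462 s0454 e164 e166
    grind (ringSteps := 300000)
  have a0 : a 0 = 0 := by clear * - hc t4 s0462; grind (ringSteps := 300000)
  have a1 : a 1 = 0 := by clear * - hc t4 a0 s1462; grind (ringSteps := 300000)
  have a2 : a 2 = 0 := by clear * - hc t4 a0 a1 s2462; grind (ringSteps := 300000)
  have a3 : a 3 = 0 := by clear * - hc t4 a0 a1 a2 s3462; grind (ringSteps := 300000)
  have b0 : b 0 = 0 := by clear * - hc t4 a0 a1 a2 a3 s0460; grind (ringSteps := 300000)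
  have b1 : b 1 = 0 := by clear * - hc t4 a0 a1 a2 a3 b0 s1460; grind (ringSteps := 300000)
  have b2 : b 2 = 0 := by clear * - hc t4 a0 a1 a2 a3 b0 b1 s2460; grind (ringSteps := 300000)
  have b3 : b 3 = 0 := by clear * - hc t4 a0 a1 a2 a3 b0 b1 b2 s3460; grind (ringSteps := 300000)
  clear * - hc t4 a0 a1 a2 a3 b0 b1 b2 b3 s4560 s4562 e452 e462 e562 s0466 e046 e066 s1466 e166
    s2466 e266 e560 e563 e450 e460 e453 e463 s0454 s0455 s0465 e045 e055 e065 e056 s1454 s1455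
    s1465 e155 e165 e156 s2454 s2465 e265 e256 e461
  grind (ringSteps := 300000)

set_option maxHeartbeats 1000000 in
theorem CurvSys.a₆_of_trace
    (h : CurvSys (fun i => prm3 (a i) (b i) (c i) (d i) (v i) (y i) (z i))
      (tab t (1 - b₆) b₅ a₆ b₆ c₆ (-a₆) v₅ v₆ y₅ y₆ z₆)) :
    a₆ = 0 := by
  obtain ⟨c0, c1, c2, c3, d0, d1, d2, d3, c5⟩ := h.linear_of_trace
  obtain ⟨t0, t1, t2, t3⟩ := h.t_of_trace
  have hc := h.c₆_of_trace
  by_contra ha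
  have s2560 := h.second 2 5 6 0
  have e460 := h.def_eq 4 6 0
  have s2561 := h.second 2 5 6 1
  have e452 := h.def_eq 4 5 2
  have e463 := h.def_eq 4 6 3
  have s0460 := h.second 0 4 6 0
  have s1460 := h.second 1 4 6 0
  have s2460 := h.second 2 4 6 0
  have s3460 := h.second 3 4 6 0
  have s4560 := h.second 4 5 6 0
  have s4562 := h.second 4 5 6 2
  have s3450 := h.second 3 4 5 0
  have s0450 := h.second 0 4 5 0
  have e121 := h.def_eq 1 2 1
  have s2450 := h.second 2 4 5 0
  have e462 := h.def_eq 4 6 2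
  have e046 := h.def_eq 0 4 6
  have s0466 := h.second 0 4 6 6
  have s1466 := h.second 1 4 6 6
  have e166 := h.def_eq 1 6 6
  have e266 := h.def_eq 2 6 6
  have s2466 := h.second 2 4 6 6
  have s0454 := h.second 0 4 5 4
  have s0455 := h.second 0 4 5 5
  have s0465 := h.second 0 4 6 5
  have s1454 := h.second 1 4 5 4
  have s1455 := h.second 1 4 5 5
  have e165 := h.def_eq 1 6 5
  have e156 := h.def_eq 1 5 6
  have s1465 := h.second 1 4 6 5
  have s2454 := h.second 2 4 5 4
  have s2465 := h.second 2 4 6 5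
  have e066 := h.def_eq 0 6 6
  simp only [Fin.sum_univ_seven, tor, hm_apply, br_apply, tab_apply, prm3_apply, Pi.neg_apply,
    Pi.zero_apply, sub_add_cancel, add_neg_cancel, mul_zero, zero_mul, add_zero, zero_add,
    sub_zero, zero_sub, neg_zero, sub_self, neg_neg, c0, c1, c2, c3, d0, d1, d2, d3, c5, t0, t1,
    t2, t3, hc] at s2560 e460 s2561 e452 e463 s0460 s1460 s2460 s3460 s4560 s4562 s3450 s0450 e121 s2450 e462 e046 s0466 s1466 e166 e266 s2466 s0454 s0455 s0465 s1454 s1455 e165 e156 s1465 s2454 s2465 e066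
  have t4 : t 4 = 0 := by
    clear * - ha s2560 e460 s2561 e452 e463 s0460 s1460 s2460 s3460 s4560 s4562
    grind (ringSteps := 300000)
  have b3 : b 3 = 0 := by clear * - ha t4 s3450; grind (ringSteps := 300000)
  have a0 : a 0 = 0 := by clear * - ha t4 b3 s0460; grind (ringSteps := 300000)
  have a1 : a 1 = 0 := by clear * - ha t4 b3 a0 s1460; grind (ringSteps := 300000)
  have a2 : a 2 = 0 := by clear * - ha t4 b3 a0 a1 s2460; grind (ringSteps := 300000)
  have a3 : a 3 = 0 := by clear * - ha t4 b3 a0 a1 a2 s3460; grind (ringSteps := 300000)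
  have b0 : b 0 = 0 := by clear * - ha t4 b3 a0 a1 a2 a3 s0450; grind (ringSteps := 300000)
  have b1 : b 1 = 0 := by clear * - ha t4 b3 a0 a1 a2 a3 b0 e121; grind (ringSteps := 300000)
  have b2 : b 2 = 0 := by clear * - ha t4 b3 a0 a1 a2 a3 b0 b1 s2450; grind (ringSteps := 300000)
  have c4 : c 4 = 0 := by
    clear * - ha t4 b3 a0 a1 a2 a3 b0 b1 b2 e462 e046 s0466 s1466 e166 e266 s2466 e460 e463 s0454
      s0455 s0465 s1454 s1455 e165 e156 s1465 s2454 s2465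
    grind (ringSteps := 300000)
  have d4 : d 4 = -a 4 := by
    clear * - ha t4 b3 a0 a1 a2 a3 b0 b1 b2 c4 s4562 e066 s0466 e166 e266 s0465 s1454 e165 e156
      s1466
    grind (ringSteps := 300000)
  clear * - ha t4 b3 a0 a1 a2 a3 b0 b1 b2 c4 d4 s0466 e166 e266 s0454 s0465 s1454 e165 e156 s1466
    e452 e046 e463
  grind (ringSteps := 300000)

set_option maxHeartbeats 1000000 in
theorem CurvSys.c_six_of_trace
    (h : CurvSys (fun i => prm3 (a i) (b i) (c i) (d i) (v i) (y i) (z i))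
      (tab t (1 - b₆) b₅ a₆ b₆ c₆ (-a₆) v₅ v₆ y₅ y₆ z₆)) :
    c 6 = 0 := by
  obtain ⟨c0, c1, c2, c3, d0, d1, d2, d3, c5⟩ := h.linear_of_trace
  obtain ⟨t0, t1, t2, t3⟩ := h.t_of_trace
  have hc := h.c₆_of_trace
  have ha := h.a₆_of_trace
  by_contra c6
  have e062 := h.def_eq 0 6 2
  have s0466 := h.second 0 4 6 6
  simp only [Fin.sum_univ_seven, tor, hm_apply, br_apply, tab_apply, prm3_apply, Pi.neg_apply,
    Pi.zero_apply, sub_add_cancel, mul_zero, zero_mul, add_zero, zero_add,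
    sub_zero, zero_sub, neg_zero, sub_self, neg_neg, c0, c1, c2, c3, d0, c5, t0, t1,
    t2, t3, hc, ha] at e062 s0466
  clear * - c6 e062 s0466
  grind (ringSteps := 300000)

set_option maxHeartbeats 1000000 in
theorem CurvSys.a_of_trace
    (h : CurvSys (fun i => prm3 (a i) (b i) (c i) (d i) (v i) (y i) (z i))
      (tab t (1 - b₆) b₅ a₆ b₆ c₆ (-a₆) v₅ v₆ y₅ y₆ z₆)) :
    a 0 = 0 ∧ a 1 = 0 ∧ a 2 = 0 ∧ a 3 = 0 ∧ c 4 = 0 := by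
  obtain ⟨c0, c1, c2, c3, d0, d1, d2, d3, c5⟩ := h.linear_of_trace
  obtain ⟨t0, t1, t2, t3⟩ := h.t_of_trace
  have hc := h.c₆_of_trace
  have ha := h.a₆_of_trace
  have c6 := h.c_six_of_trace
  have e010 := h.def_eq 0 1 0
  have e020 := h.def_eq 0 2 0
  have e030 := h.def_eq 0 3 0
  have e040 := h.def_eq 0 4 0
  have e050 := h.def_eq 0 5 0
  have e150 := h.def_eq 1 5 0
  have e230 := h.def_eq 2 3 0
  have e240 := h.def_eq 2 4 0
  have e250 := h.def_eq 2 5 0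
  have e350 := h.def_eq 3 5 0
  have e450 := h.def_eq 4 5 0
  have s0251 := h.second 0 2 5 1
  have s0451 := h.second 0 4 5 1
  have s3451 := h.second 3 4 5 1
  have e011 := h.def_eq 0 1 1
  have e021 := h.def_eq 0 2 1
  have e031 := h.def_eq 0 3 1
  have e041 := h.def_eq 0 4 1
  have e051 := h.def_eq 0 5 1
  have e061 := h.def_eq 0 6 1
  have e151 := h.def_eq 1 5 1
  have e261 := h.def_eq 2 6 1
  have e351 := h.def_eq 3 5 1
  have e361 := h.def_eq 3 6 1
  have e451 := h.def_eq 4 5 1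
  have e461 := h.def_eq 4 6 1
  have e042 := h.def_eq 0 4 2
  have e043 := h.def_eq 0 4 3
  have e053 := h.def_eq 0 5 3
  have e153 := h.def_eq 1 5 3
  have e243 := h.def_eq 2 4 3
  have e253 := h.def_eq 2 5 3
  have e353 := h.def_eq 3 5 3
  have e453 := h.def_eq 4 5 3
  have s0454 := h.second 0 4 5 4
  have s3454 := h.second 3 4 5 4
  have e014 := h.def_eq 0 1 4
  have e024 := h.def_eq 0 2 4
  have e034 := h.def_eq 0 3 4
  have e044 := h.def_eq 0 4 4
  have e064 := h.def_eq 0 6 4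
  have e124 := h.def_eq 1 2 4
  have e154 := h.def_eq 1 5 4
  have e234 := h.def_eq 2 3 4
  have e244 := h.def_eq 2 4 4
  have e254 := h.def_eq 2 5 4
  have e264 := h.def_eq 2 6 4
  have e354 := h.def_eq 3 5 4
  have e015 := h.def_eq 0 1 5
  have e045 := h.def_eq 0 4 5
  have e065 := h.def_eq 0 6 5
  have e155 := h.def_eq 1 5 5
  have s0346 := h.second 0 3 4 6
  have e016 := h.def_eq 0 1 6
  have e026 := h.def_eq 0 2 6
  have e056 := h.def_eq 0 5 6
  have e256 := h.def_eq 2 5 6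
  have s0465 := h.second 0 4 6 5
  have s1455 := h.second 1 4 5 5
  have s2465 := h.second 2 4 6 5
  have e060 := h.def_eq 0 6 0
  have e260 := h.def_eq 2 6 0
  have e360 := h.def_eq 3 6 0
  have e560 := h.def_eq 5 6 0
  have e052 := h.def_eq 0 5 2
  have e562 := h.def_eq 5 6 2
  have e066 := h.def_eq 0 6 6
  have s0466 := h.second 0 4 6 6
  have e120 := h.def_eq 1 2 0
  have e140 := h.def_eq 1 4 0
  have e121 := h.def_eq 1 2 1
  have e131 := h.def_eq 1 3 1
  have e141 := h.def_eq 1 4 1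
  have e241 := h.def_eq 2 4 1
  have e142 := h.def_eq 1 4 2
  have e242 := h.def_eq 2 4 2
  have e143 := h.def_eq 1 4 3
  have s1454 := h.second 1 4 5 4
  have s2454 := h.second 2 4 5 4
  have e144 := h.def_eq 1 4 4
  have e364 := h.def_eq 3 6 4
  have e125 := h.def_eq 1 2 5
  have e135 := h.def_eq 1 3 5
  have e145 := h.def_eq 1 4 5
  have e265 := h.def_eq 2 6 5
  have e345 := h.def_eq 3 4 5
  have s1346 := h.second 1 3 4 6
  have e126 := h.def_eq 1 2 6
  have e136 := h.def_eq 1 3 6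
  have e146 := h.def_eq 1 4 6
  have e246 := h.def_eq 2 4 6
  have s4564 := h.second 4 5 6 4
  have s3465 := h.second 3 4 6 5
  have e156 := h.def_eq 1 5 6
  have s1466 := h.second 1 4 6 6
  have e161 := h.def_eq 1 6 1
  have e152 := h.def_eq 1 5 2
  have e252 := h.def_eq 2 5 2
  have e164 := h.def_eq 1 6 4
  have e166 := h.def_eq 1 6 6
  have e452 := h.def_eq 4 5 2
  have e165 := h.def_eq 1 6 5
  have e266 := h.def_eq 2 6 6
  have e130 := h.def_eq 1 3 0
  have e340 := h.def_eq 3 4 0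
  have s0455 := h.second 0 4 5 5
  have e025 := h.def_eq 0 2 5
  have e046 := h.def_eq 0 4 6
  have e160 := h.def_eq 1 6 0
  have e460 := h.def_eq 4 6 0
  have e463 := h.def_eq 4 6 3
  have s2351 := h.second 2 3 5 1
  have e231 := h.def_eq 2 3 1
  have e342 := h.def_eq 3 4 2
  have e344 := h.def_eq 3 4 4
  have e235 := h.def_eq 2 3 5
  have e236 := h.def_eq 2 3 6
  have e346 := h.def_eq 3 4 6
  have s3464 := h.second 3 4 6 4
  have e352 := h.def_eq 3 5 2
  have e366 := h.def_eq 3 6 6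
  have e054 := h.def_eq 0 5 4
  have e035 := h.def_eq 0 3 5
  have e036 := h.def_eq 0 3 6
  have e343 := h.def_eq 3 4 3
  have e462 := h.def_eq 4 6 2
  have s2451 := h.second 2 4 5 1
  have e251 := h.def_eq 2 5 1
  have e561 := h.def_eq 5 6 1
  have s2346 := h.second 2 3 4 6
  have s4561 := h.second 4 5 6 1
  have e566 := h.def_eq 5 6 6
  have s4560 := h.second 4 5 6 0
  have e055 := h.def_eq 0 5 5
  have s1255 := h.second 1 2 5 5
  have e365 := h.def_eq 3 6 5
  have e356 := h.def_eq 3 5 6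
  have s2466 := h.second 2 4 6 6
  have s1465 := h.second 1 4 6 5
  simp only [Fin.sum_univ_seven, tor, hm_apply, br_apply, tab_apply, prm3_apply, Pi.neg_apply,
    Pi.zero_apply, sub_add_cancel, mul_zero, zero_mul, add_zero, zero_add,
    sub_zero, zero_sub, neg_zero, sub_self, neg_neg, c0, c1, c2, c3, d0, d1, d2, d3, c5, t0, t1,
    t2, t3, hc, ha, c6] at e010 e020 e030 e040 e050 e150 e230 e240 e250 e350 e450 s0251 s0451 s3451 e011 e021 e031 e041 e051 e061 e151 e261 e351 e361 e451 e461 e042 e043 e053 e153 e243 e253 e353 e453 s0454 s3454 e014 e024 e034 e044 e064 e124 e154 e234 e244 e254 e264 e354 e015 e045 e065 e155 s0346 e016 e026 e056 e256 s0465 s1455 s2465 e060 e260 e360 e560 e052 e562 e066 s0466 e120 e140 e121 e131 e141 e241 e142 e242 e143 s1454 s2454 e144 e364 e125 e135 e145 e265 e345 s1346 e126 e136 e146 e246 s4564 s3465 e156 s1466 e161 e152 e252 e164 e166 e452 e165 e266 e130 e340 s0455 e025 e046 e160 e460 e463 s2351 e231 e342 e344 e235 e236 e346 s3464 e352 e366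 e054 e035 e036 e343 e462 s2451 e251 e561 s2346 s4561 e566 s4560 e055 s1255 e365 e356 s2466 s1465
  have a0 : a 0 = 0 := by
    clear * - e010 e020 e030 e040 e050 e150 e230 e240 e250 e350 e450 s0251 s0451 s3451 e011 e021
      e031 e041 e051 e061 e151 e261 e351 e361 e451 e461 e042 e043 e053 e153 e243 e253 e353 e453
      s0454 s3454 e014 e024 e034 e044 e064 e124 e154 e234 e244 e254 e264 e354 e015 e045 e065 e155
      s0346 e016 e026 e056 e256 s0465 s1455 s2465 e060 e260 e360 e560 e052 e562 e066 s0466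
    grind (ringSteps := 300000)
  have a1 : a 1 = 0 := by
    clear * - a0 e120 e140 e121 e131 e141 e151 e241 e261 e461 e142 e242 e143 e243 s1454 s2454
      s3454 e124 e144 e234 e364 e125 e135 e145 e155 e265 e345 s1346 e126 e136 e146 e246 e256 s4564
      s1455 s2465 s3465 e156 s1466 e161 e152 e252 e164 e166 e452 e165 e266 e020 e130 e150 e250
      e340 e450 e041 e153 e253 e453 s0455 e015 e025 e045 e065 e016 e026 e046 s0465 e060 e160 e260
      e460 e463
    grind (ringSteps := 300000)
  have a3 : a 3 = 0 := by
    clear * - a0 a1 s2351 s3451 e231 e361 e342 s2454 s3454 e344 e235 e265 e236 e256 e346 s3464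
      e352 e366 e452 e266 e350 e031 e353 s0454 e024 e054 e035 e045 e036 e046 e066 e131 s1454 e135
      e155 e136 e156 e165 e230 e340 e343 e360 e463
    grind (ringSteps := 300000)
  have c4 : c 4 = 0 := by
    clear * - a0 a1 a3 e242 e562 e462 e450 e453 e460 e463
    grind (ringSteps := 300000)
  have a2 : a 2 = 0 := by
    clear * - a0 a1 a3 c4 s2451 e241 e251 e261 e561 e244 e254 e264 e265 s2346 e256 s4561 s4564
      e252 e562 e566 e266 s4560 e050 s0451 e041 e061 s0454 e044 s0455 e025 e045 e055 e065 e026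
      e056 s0465 e066 e121 e151 s1454 e124 e154 e125 e155 e126 s1255 e156 e161 e166 e165 e150 e250
      e153 e253 e015 e260 e560 e231 s3454 e354 e235 e365 e236 e356 s3465 e461 e246 s2465 s2466
      e452 e046 e144 e145 e146 s1455 s1465 e140 e240 e243 e340 e450 e453 e460 e463
    grind (ringSteps := 300000)
  exact ⟨a0, a1, a2, a3, c4⟩

set_option maxHeartbeats 1000000 in
theorem CurvSys.false_of_trace
    (h : CurvSys (fun i => prm3 (a i) (b i) (c i) (d i) (v i) (y i) (z i))
      (tab t (1 - b₆) b₅ a₆ b₆ c₆ (-a₆) v₅ v₆ y₅ y₆ z₆)) :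
    False := by
  obtain ⟨c0, c1, c2, c3, d0, d1, d2, d3, c5⟩ := h.linear_of_trace
  obtain ⟨t0, t1, t2, t3⟩ := h.t_of_trace
  have hc := h.c₆_of_trace
  have ha := h.a₆_of_trace
  have c6 := h.c_six_of_trace
  obtain ⟨a0, a1, a2, a3, c4⟩ := h.a_of_trace
  have e034 := h.def_eq 0 3 4
  have e121 := h.def_eq 1 2 1
  have s1454 := h.second 1 4 5 4
  have s4561 := h.second 4 5 6 1
  have s4560 := h.second 4 5 6 0
  have s3451 := h.second 3 4 5 1
  have e026 := h.def_eq 0 2 6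
  have s2465 := h.second 2 4 6 5
  have e450 := h.def_eq 4 5 0
  have e453 := h.def_eq 4 5 3
  have e463 := h.def_eq 4 6 3
  have e461 := h.def_eq 4 6 1
  have s1451 := h.second 1 4 5 1
  have s1465 := h.second 1 4 6 5
  have e125 := h.def_eq 1 2 5
  have s0451 := h.second 0 4 5 1
  have e050 := h.def_eq 0 5 0
  have e053 := h.def_eq 0 5 3
  have e061 := h.def_eq 0 6 1
  have e065 := h.def_eq 0 6 5
  have e261 := h.def_eq 2 6 1
  have e256 := h.def_eq 2 5 6
  have e452 := h.def_eq 4 5 2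
  have s2455 := h.second 2 4 5 5
  have e265 := h.def_eq 2 6 5
  have e460 := h.def_eq 4 6 0
  have s1455 := h.second 1 4 5 5
  have e155 := h.def_eq 1 5 5
  have s0465 := h.second 0 4 6 5
  have e025 := h.def_eq 0 2 5
  have s2561 := h.second 2 5 6 1
  have s4564 := h.second 4 5 6 4
  have s3454 := h.second 3 4 5 4
  have e365 := h.def_eq 3 6 5
  have s3465 := h.second 3 4 6 5
  have s4566 := h.second 4 5 6 6
  have s2451 := h.second 2 4 5 1
  have s2454 := h.second 2 4 5 4
  have e250 := h.def_eq 2 5 0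
  have e560 := h.def_eq 5 6 0
  have e563 := h.def_eq 5 6 3
  have e235 := h.def_eq 2 3 5
  have e350 := h.def_eq 3 5 0
  have e354 := h.def_eq 3 5 4
  have e241 := h.def_eq 2 4 1
  have e244 := h.def_eq 2 4 4
  have e564 := h.def_eq 5 6 4
  have e344 := h.def_eq 3 4 4
  have e464 := h.def_eq 4 6 4
  have e254 := h.def_eq 2 5 4
  have e246 := h.def_eq 2 4 6
  have e145 := h.def_eq 1 4 5
  have e351 := h.def_eq 3 5 1
  have e561 := h.def_eq 5 6 1
  have e341 := h.def_eq 3 4 1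
  have e251 := h.def_eq 2 5 1
  have e356 := h.def_eq 3 5 6
  have e566 := h.def_eq 5 6 6
  have e466 := h.def_eq 4 6 6
  have e266 := h.def_eq 2 6 6
  have s0455 := h.second 0 4 5 5
  have e045 := h.def_eq 0 4 5
  have e055 := h.def_eq 0 5 5
  simp only [Fin.sum_univ_seven, tor, hm_apply, br_apply, tab_apply, prm3_apply, Pi.neg_apply,
    Pi.zero_apply, sub_add_cancel, mul_zero, zero_mul, add_zero, zero_add,
    sub_zero, zero_sub, neg_zero, sub_self, neg_neg, c0, c1, c2, c3, d0, d1, d2, d3, c5, t0, t1,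
    t2, t3, hc, ha, c6, a0, a1, a2, a3, c4] at e034 e121 s1454 s4561 s4560 s3451 e026 s2465 e450 e453 e463 e461 s1451 s1465 e125 s0451 e050 e053 e061 e065 e261 e256 e452 s2455 e265 e460 s1455 e155 s0465 e025 s2561 s4564 s3454 e365 s3465 s4566 s2451 s2454 e250 e560 e563 e235 e350 e354 e241 e244 e564 e344 e464 e254 e246 e145 e351 e561 e341 e251 e356 e566 e466 e266 s0455 e045 e055
  have v0 : v 0 = 0 := by clear * - e034; grind (ringSteps := 300000)
  have b1 : b 1 = 0 := by clear * - v0 e121; grind (ringSteps := 300000)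
  have v1 : v 1 = 0 := by clear * - v0 b1 s1454; grind (ringSteps := 300000)
  have z1 : z 1 = 0 := by
    clear * - v0 b1 v1 s4561 s4560 s3451 e026 s2465 e450 e453 e463 e461 s1451 s1465 e125
    grind (ringSteps := 300000)
  have b0 : b 0 = 0 := by
    clear * - v0 b1 v1 z1 s0451 e050 e053 e061 e065 e261 e256
    grind (ringSteps := 300000)
  have z0 : z 0 = 0 := by
    clear * - v0 b1 v1 z1 b0 e452 s2455 e265 s2465 e450 e453 e460 s1455 e155 s0451 s0465 e025
    grind (ringSteps := 300000)
  clear * - v0 b1 v1 z1 b0 z0 s2561 s4561 s4564 s3451 s3454 e365 s3465 s4566 s2451 s2454 s2455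
    e265 e250 e560 e563 e235 e350 s2465 e450 e453 e460 e463 e354 e241 e244 e564 e344 e464 e254
    e246 s1455 e155 e145 e351 e561 e341 e461 e251 e356 e566 e466 e256 e266 s0455 s0465 e045 e055
  grind (ringSteps := 300000)

end Trace

section Nilpotent

variable {K : Type*} [Field K] [CharZero K] {a b c d v y z : Fin 7 → K} {t : Fin 5 → K}
  {b₅ b₆ a₆ c₆ y₅ y₆ z₆ : K}

set_option maxHeartbeats 1000000 in
theorem CurvSys.linear_of_v
    (h : CurvSys (fun i => prm3 (a i) (b i) (c i) (d i) (v i) (y i) (z i))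
      (tab t (-b₆) b₅ a₆ b₆ c₆ (-a₆) 1 0 y₅ y₆ z₆)) :
    c 0 = 0 ∧ c 1 = 0 ∧ c 2 = 0 ∧ c 3 = 0 ∧ c 5 = 3 * a 6 + 2 * d 6 ∧
      ∃ x : Fin 4 → K, a 0 = 2 * x 0 ∧ a 1 = 2 * x 1 ∧ a 2 = 2 * x 2 ∧ a 3 = 2 * x 3 ∧
        d 0 = -3 * x 0 ∧ d 1 = -3 * x 1 ∧ d 2 = -3 * x 2 ∧ d 3 = -3 * x 3 := by
  have s0464 := h.second 0 4 6 4
  have s0454 := h.second 0 4 5 4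
  have s1464 := h.second 1 4 6 4
  have s1454 := h.second 1 4 5 4
  have s2464 := h.second 2 4 6 4
  have s2454 := h.second 2 4 5 4
  have s3464 := h.second 3 4 6 4
  have s3454 := h.second 3 4 5 4
  have s4564 := h.second 4 5 6 4
  simp only [Fin.sum_univ_seven, tor, hm_apply, br_apply, tab_apply, prm3_apply, Pi.neg_apply,
    Pi.zero_apply, add_neg_cancel, mul_zero, add_zero, zero_add,
    sub_zero, zero_sub, neg_zero, sub_self, neg_neg, neg_mul] at s0464 s0454 s1464 s1454 s2464 s2454 s3464 s3454 s4564
  refine ⟨?_, ?_, ?_, ?_, ?_, ![-(a 0 + d 0), -(a 1 + d 1), -(a 2 + d 2), -(a 3 + d 3)], ?_⟩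
  · clear * - s0464; grind
  · clear * - s1464; grind
  · clear * - s2464; grind
  · clear * - s3464; grind
  · clear * - s4564; grind
  · simp only [Matrix.cons_val]
    refine ⟨?_, ?_, ?_, ?_, ?_, ?_, ?_, ?_⟩
    · clear * - s0464 s0454; grind
    · clear * - s1464 s1454; grind
    · clear * - s2464 s2454; grind
    · clear * - s3464 s3454; grind
    · clear * - s0464 s0454; grind
    · clear * - s1464 s1454; grind
    · clear * - s2464 s2454; grind
    · clear * - s3464 s3454; grind

set_option maxHeartbeats 1000000 in
theorem CurvSys.t_zero_of_v
    (h : CurvSys (fun i => prm3 (a i) (b i) (c i) (d i) (v i) (y i) (z i))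
      (tab t (-b₆) b₅ a₆ b₆ c₆ (-a₆) 1 0 y₅ y₆ z₆)) :
    t 0 = 0 := by
  obtain ⟨c0, c1, c2, c3, c5, x, a0, a1, a2, a3, d0, d1, d2, d3⟩ := h.linear_of_v
  by_contra t0
  have s0160 := h.second 0 1 6 0
  have s0162 := h.second 0 1 6 2
  have s1360 := h.second 1 3 6 0
  have s1362 := h.second 1 3 6 2
  have e142 := h.def_eq 1 4 2
  have e162 := h.def_eq 1 6 2
  have e060 := h.def_eq 0 6 0
  have e360 := h.def_eq 3 6 0
  have e016 := h.def_eq 0 1 6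
  have e015 := h.def_eq 0 1 5
  have e136 := h.def_eq 1 3 6
  have e135 := h.def_eq 1 3 5
  have s3466 := h.second 3 4 6 6
  simp only [Fin.sum_univ_seven, tor, hm_apply, br_apply, tab_apply, prm3_apply, Pi.neg_apply,
    Pi.zero_apply, add_neg_cancel, mul_zero, zero_mul, add_zero, zero_add,
    sub_zero, zero_sub, neg_zero, sub_self, neg_neg, c0, c1, c2, c3, c5, a0, a1, a2, a3, d0, d1,
    d3] at s0160 s0162 s1360 s1362 e142 e162 e060 e360 e016 e015 e136 e135 s3466
  have b0 : b 0 = 0 := by clear * - t0 s0160 s0162; grind (ringSteps := 300000)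
  have x0 : x 0 = 0 := by clear * - t0 b0 s0162; grind (ringSteps := 300000)
  have b3 : b 3 = 0 := by clear * - t0 b0 x0 s1360 s1362; grind (ringSteps := 300000)
  have x3 : x 3 = 0 := by clear * - t0 b0 x0 b3 s1362; grind (ringSteps := 300000)
  have c4 : c 4 = 0 := by clear * - t0 b0 x0 b3 x3 e142 e162; grind (ringSteps := 300000)
  have v0 : v 0 = 0 := by clear * - t0 b0 x0 b3 x3 c4 e162 e060; grind (ringSteps := 300000)
  have v3 : v 3 = 0 := by clear * - t0 b0 x0 b3 x3 c4 v0 e162 e360; grind (ringSteps := 300000)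
  clear * - t0 b0 x0 b3 x3 c4 v0 v3 e162 e016 e015 e136 e135 s3466
  grind (ringSteps := 300000)

set_option maxHeartbeats 1000000 in
theorem CurvSys.t_of_v
    (h : CurvSys (fun i => prm3 (a i) (b i) (c i) (d i) (v i) (y i) (z i))
      (tab t (-b₆) b₅ a₆ b₆ c₆ (-a₆) 1 0 y₅ y₆ z₆)) :
    t 0 = 0 ∧ t 1 = 0 ∧ t 2 = 0 ∧ t 3 = 0 := by
  obtain ⟨c0, c1, c2, c3, c5, x, a0, a1, a2, a3, d0, d1, d2, d3⟩ := h.linear_of_v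
  have t0 := h.t_zero_of_v
  have e160 := h.def_eq 1 6 0
  have e152 := h.def_eq 1 5 2
  have e262 := h.def_eq 2 6 2
  have s0160 := h.second 0 1 6 0
  have s1262 := h.second 1 2 6 2
  have e150 := h.def_eq 1 5 0
  have e252 := h.def_eq 2 5 2
  have e153 := h.def_eq 1 5 3
  have s1250 := h.second 1 2 5 0
  have s1562 := h.second 1 5 6 2
  have e121 := h.def_eq 1 2 1
  have e562 := h.def_eq 5 6 2
  have e253 := h.def_eq 2 5 3
  have s0250 := h.second 0 2 5 0
  have s1251 := h.second 1 2 5 1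
  have s2560 := h.second 2 5 6 0
  have s1560 := h.second 1 5 6 0
  simp only [Fin.sum_univ_seven, tor, hm_apply, br_apply, tab_apply, prm3_apply, Pi.neg_apply,
    Pi.zero_apply, add_neg_cancel, mul_zero, zero_mul, add_zero, zero_add,
    sub_zero, zero_sub, neg_zero, sub_self, neg_neg, c0, c1, c2, c3, c5, a0, a1, a2, a3, d0, d1,
    d2, d3, t0] at e160 e152 e262 s0160 s1262 e150 e252 e153 s1250 s1562 e121 e562 e253 s0250 s1251 s2560 s1560
  have t1 : t 1 = 0 := by clear * - e160 e152 e262 s0160 s1262; grind (ringSteps := 300000)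
  have t2 : t 2 = 0 := by clear * - t1 e150 e252 e153 s1250 e152 s1562; grind (ringSteps := 300000)
  have t3 : t 3 = 0 := by
    clear * - t1 t2 e121 e562 e253 s0250 s1251 s1250 s2560 s1560
    grind (ringSteps := 300000)
  exact ⟨t0, t1, t2, t3⟩

set_option maxHeartbeats 1000000 in
theorem CurvSys.c₆_of_v
    (h : CurvSys (fun i => prm3 (a i) (b i) (c i) (d i) (v i) (y i) (z i))
      (tab t (-b₆) b₅ a₆ b₆ c₆ (-a₆) 1 0 y₅ y₆ z₆)) :
    c₆ = 0 := by
  obtain ⟨c0, c1, c2, c3, c5, x, a0, a1, a2, a3, d0, d1, d2, d3⟩ := h.linear_of_v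
  obtain ⟨t0, t1, t2, t3⟩ := h.t_of_v
  by_contra hc
  have s2450 := h.second 2 4 5 0
  have s2460 := h.second 2 4 6 0
  have s2560 := h.second 2 5 6 0
  have s2462 := h.second 2 4 6 2
  have e462 := h.def_eq 4 6 2
  have s0462 := h.second 0 4 6 2
  have s1462 := h.second 1 4 6 2
  have s3462 := h.second 3 4 6 2
  have s0460 := h.second 0 4 6 0
  have s1460 := h.second 1 4 6 0
  have s3460 := h.second 3 4 6 0
  have e034 := h.def_eq 0 3 4
  have e452 := h.def_eq 4 5 2
  have e562 := h.def_eq 5 6 2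
  have e144 := h.def_eq 1 4 4
  have s1466 := h.second 1 4 6 6
  have e146 := h.def_eq 1 4 6
  have e166 := h.def_eq 1 6 6
  have e244 := h.def_eq 2 4 4
  have s2466 := h.second 2 4 6 6
  have e246 := h.def_eq 2 4 6
  have e266 := h.def_eq 2 6 6
  have s3466 := h.second 3 4 6 6
  have e346 := h.def_eq 3 4 6
  have e366 := h.def_eq 3 6 6
  have e136 := h.def_eq 1 3 6
  have e450 := h.def_eq 4 5 0
  have e460 := h.def_eq 4 6 0
  have e453 := h.def_eq 4 5 3
  have e463 := h.def_eq 4 6 3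
  have s1455 := h.second 1 4 5 5
  have s1465 := h.second 1 4 6 5
  have e145 := h.def_eq 1 4 5
  have e155 := h.def_eq 1 5 5
  have e165 := h.def_eq 1 6 5
  have e156 := h.def_eq 1 5 6
  have s2465 := h.second 2 4 6 5
  have e245 := h.def_eq 2 4 5
  have e256 := h.def_eq 2 5 6
  have s2455 := h.second 2 4 5 5
  have s3455 := h.second 3 4 5 5
  have s3465 := h.second 3 4 6 5
  have e345 := h.def_eq 3 4 5
  have e355 := h.def_eq 3 5 5
  have e365 := h.def_eq 3 6 5
  have e356 := h.def_eq 3 5 6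
  have e135 := h.def_eq 1 3 5
  have e461 := h.def_eq 4 6 1
  have e164 := h.def_eq 1 6 4
  have e264 := h.def_eq 2 6 4
  have e344 := h.def_eq 3 4 4
  have e364 := h.def_eq 3 6 4
  have e154 := h.def_eq 1 5 4
  have e354 := h.def_eq 3 5 4
  have s4562 := h.second 4 5 6 2
  have s0466 := h.second 0 4 6 6
  have e560 := h.def_eq 5 6 0
  have e563 := h.def_eq 5 6 3
  have s0455 := h.second 0 4 5 5
  have s0465 := h.second 0 4 6 5
  have e046 := h.def_eq 0 4 6
  have e066 := h.def_eq 0 6 6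
  have e045 := h.def_eq 0 4 5
  have e065 := h.def_eq 0 6 5
  have e056 := h.def_eq 0 5 6
  have e265 := h.def_eq 2 6 5
  have s4560 := h.second 4 5 6 0
  have s4561 := h.second 4 5 6 1
  have e451 := h.def_eq 4 5 1
  have e255 := h.def_eq 2 5 5
  simp only [Fin.sum_univ_seven, tor, hm_apply, br_apply, tab_apply, prm3_apply, Pi.neg_apply,
    Pi.zero_apply, add_neg_cancel, mul_zero, zero_mul, add_zero, zero_add,
    sub_zero, zero_sub, neg_zero, sub_self, neg_neg, c0, c1, c2, c3, c5, a0, a1, a2, a3, d0, d1,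
    d2, d3, t0, t1, t2, t3] at s2450 s2460 s2560 s2462 e462 s0462 s1462 s3462 s0460 s1460 s3460 e034 e452 e562 e144 s1466 e146 e166 e244 s2466 e246 e266 s3466 e346 e366 e136 e450 e460 e453 e463 s1455 s1465 e145 e155 e165 e156 s2465 e245 e256 s2455 s3455 s3465 e345 e355 e365 e356 e135 e461 e164 e264 e344 e364 e154 e354 s4562 s0466 e560 e563 s0455 s0465 e046 e066 e045 e065 e056 e265 s4560 s4561 e451 e255
  have t4 : t 4 = 0 := by clear * - hc s2450 s2460 s2560 s2462 e462; grind (ringSteps := 300000)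
  have x0 : x 0 = 0 := by clear * - hc t4 s0462; grind (ringSteps := 300000)
  have x1 : x 1 = 0 := by clear * - hc t4 x0 s1462; grind (ringSteps := 300000)
  have x2 : x 2 = 0 := by clear * - hc t4 x0 x1 s2462; grind (ringSteps := 300000)
  have x3 : x 3 = 0 := by clear * - hc t4 x0 x1 x2 s3462; grind (ringSteps := 300000)
  have b0 : b 0 = 0 := by clear * - hc t4 x0 x1 x2 x3 s0460; grind (ringSteps := 300000)
  have b1 : b 1 = 0 := by clear * - hc t4 x0 x1 x2 x3 b0 s1460; grind (ringSteps := 300000)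
  have b2 : b 2 = 0 := by clear * - hc t4 x0 x1 x2 x3 b0 b1 s2460; grind (ringSteps := 300000)
  have b3 : b 3 = 0 := by clear * - hc t4 x0 x1 x2 x3 b0 b1 b2 s3460; grind (ringSteps := 300000)
  have v0 : v 0 = 0 := by clear * - hc t4 x0 x1 x2 x3 b0 b1 b2 b3 e034; grind (ringSteps := 300000)
  have v1 : v 1 = 0 := by
    clear * - hc t4 x0 x1 x2 x3 b0 b1 b2 b3 v0 e452 e462 e562 e144 s1466 e146 e166 e244 s2466 e246
      e266 s3466 e346 e366 e136 e450 e460 e453 e463 s1455 s1465 e145 e155 e165 e156 s2465 e245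
      e256 s2455 s3455 s3465 e345 e355 e365 e356 e135 e461 e164 e264 e344 e364 e154 e354
    grind (ringSteps := 300000)
  have v2 : v 2 = 0 := by
    clear * - hc t4 x0 x1 x2 x3 b0 b1 b2 b3 v0 v1 e462 e164 e264
    grind (ringSteps := 300000)
  have z0 : z 0 = 0 := by
    clear * - hc t4 x0 x1 x2 x3 b0 b1 b2 b3 v0 v1 v2 s4562 e452 e462 e562 s0466 s1466 s2466 e560
      e563 s3466 e346 e366 e450 e460 e453 e463 s0455 s0465 s1455 s1465 s2465 s3455 s3465 e345 e365
      e461 e046 e066 e045 e065 e056 e166 e155 e165 e156 e364 e266 e265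
    grind (ringSteps := 300000)
  have y0 : y 0 = 0 := by
    clear * - hc t4 x0 x1 x2 x3 b0 b1 b2 b3 v0 v1 v2 z0 s0466
    grind (ringSteps := 300000)
  clear * - hc t4 x0 x1 x2 x3 b0 b1 b2 b3 v0 v1 v2 z0 y0 s4560 s4562 e452 e462 e562 s4561 s1466
    s2466 e560 e563 s3466 e450 e460 e453 e463 s1455 s1465 s2465 s2455 s3455 s3465 e451 e461 e146
    e145 e364 e246 e245 e354 e344 e346 e366 e356 e166 e156 e266 e256 e345 e355 e365 e155 e165 e255
    e265
  grind (ringSteps := 300000)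

set_option maxHeartbeats 1000000 in
theorem CurvSys.a₆_of_v
    (h : CurvSys (fun i => prm3 (a i) (b i) (c i) (d i) (v i) (y i) (z i))
      (tab t (-b₆) b₅ a₆ b₆ c₆ (-a₆) 1 0 y₅ y₆ z₆)) :
    a₆ = 0 := by
  obtain ⟨c0, c1, c2, c3, c5, x, a0, a1, a2, a3, d0, d1, d2, d3⟩ := h.linear_of_v
  obtain ⟨t0, t1, t2, t3⟩ := h.t_of_v
  have hc := h.c₆_of_v
  by_contra ha
  have s0450 := h.second 0 4 5 0
  have s1450 := h.second 1 4 5 0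
  have s2560 := h.second 2 5 6 0
  have e240 := h.def_eq 2 4 0
  have e250 := h.def_eq 2 5 0
  have e460 := h.def_eq 4 6 0
  have e251 := h.def_eq 2 5 1
  have e253 := h.def_eq 2 5 3
  have s0460 := h.second 0 4 6 0
  have s1460 := h.second 1 4 6 0
  have s2460 := h.second 2 4 6 0
  have s3460 := h.second 3 4 6 0
  have e121 := h.def_eq 1 2 1
  have s2450 := h.second 2 4 5 0
  have s3450 := h.second 3 4 5 0
  have e034 := h.def_eq 0 3 4
  have e452 := h.def_eq 4 5 2
  have e562 := h.def_eq 5 6 2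
  have s4560 := h.second 4 5 6 0
  have s4562 := h.second 4 5 6 2
  have e462 := h.def_eq 4 6 2
  have e144 := h.def_eq 1 4 4
  have e146 := h.def_eq 1 4 6
  have s1466 := h.second 1 4 6 6
  have e166 := h.def_eq 1 6 6
  have e246 := h.def_eq 2 4 6
  have e266 := h.def_eq 2 6 6
  have s2466 := h.second 2 4 6 6
  have e346 := h.def_eq 3 4 6
  have e366 := h.def_eq 3 6 6
  have s3466 := h.second 3 4 6 6
  have e136 := h.def_eq 1 3 6
  have s1455 := h.second 1 4 5 5
  have e145 := h.def_eq 1 4 5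
  have e165 := h.def_eq 1 6 5
  have e156 := h.def_eq 1 5 6
  have s1465 := h.second 1 4 6 5
  have s2465 := h.second 2 4 6 5
  have s3455 := h.second 3 4 5 5
  have s3465 := h.second 3 4 6 5
  have e365 := h.def_eq 3 6 5
  have e356 := h.def_eq 3 5 6
  have e135 := h.def_eq 1 3 5
  have e164 := h.def_eq 1 6 4
  have e264 := h.def_eq 2 6 4
  have e364 := h.def_eq 3 6 4
  have e154 := h.def_eq 1 5 4
  have e236 := h.def_eq 2 3 6
  have e235 := h.def_eq 2 3 5
  have s0466 := h.second 0 4 6 6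
  have s0465 := h.second 0 4 6 5
  have e560 := h.def_eq 5 6 0
  have e563 := h.def_eq 5 6 3
  have e450 := h.def_eq 4 5 0
  have e453 := h.def_eq 4 5 3
  have e463 := h.def_eq 4 6 3
  have e461 := h.def_eq 4 6 1
  have e245 := h.def_eq 2 4 5
  have e344 := h.def_eq 3 4 4
  have e256 := h.def_eq 2 5 6
  have e345 := h.def_eq 3 4 5
  have e355 := h.def_eq 3 5 5
  have e155 := h.def_eq 1 5 5
  have e265 := h.def_eq 2 6 5
  simp only [Fin.sum_univ_seven, tor, hm_apply, br_apply, tab_apply, prm3_apply, Pi.neg_apply,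
    Pi.zero_apply, add_neg_cancel, mul_zero, zero_mul, add_zero, zero_add,
    sub_zero, zero_sub, neg_zero, sub_self, neg_neg, c0, c1, c2, c3, c5, a0, a1, a2, a3, d0, d1,
    d2, d3, t0, t1, t2, t3, hc] at s0450 s1450 s2560 e240 e250 e460 e251 e253 s0460 s1460 s2460 s3460 e121 s2450 s3450 e034 e452 e562 s4560 s4562 e462 e144 e146 s1466 e166 e246 e266 s2466 e346 e366 s3466 e136 s1455 e145 e165 e156 s1465 s2465 s3455 s3465 e365 e356 e135 e164 e264 e364 e154 e236 e235 s0466 s0465 e560 e563 e450 e453 e463 e461 e245 e344 e256 e345 e355 e155 e265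
  have t4 : t 4 = 0 := by
    clear * - ha s0450 s1450 s2560 e240 e250 e460 e251 e253 s0460 s1460 s2460 s3460
    grind (ringSteps := 300000)
  have x0 : x 0 = 0 := by clear * - ha t4 s0460; grind (ringSteps := 300000)
  have x1 : x 1 = 0 := by clear * - ha t4 x0 s1460; grind (ringSteps := 300000)
  have x2 : x 2 = 0 := by clear * - ha t4 x0 x1 s2460; grind (ringSteps := 300000)
  have x3 : x 3 = 0 := by clear * - ha t4 x0 x1 x2 s3460; grind (ringSteps := 300000)
  have b0 : b 0 = 0 := by clear * - ha t4 x0 x1 x2 x3 s0450; grind (ringSteps := 300000)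
  have b1 : b 1 = 0 := by clear * - ha t4 x0 x1 x2 x3 b0 e121; grind (ringSteps := 300000)
  have b2 : b 2 = 0 := by clear * - ha t4 x0 x1 x2 x3 b0 b1 s2450; grind (ringSteps := 300000)
  have b3 : b 3 = 0 := by clear * - ha t4 x0 x1 x2 x3 b0 b1 b2 s3450; grind (ringSteps := 300000)
  have v0 : v 0 = 0 := by clear * - ha t4 x0 x1 x2 x3 b0 b1 b2 b3 e034; grind (ringSteps := 300000)
  have v1 : v 1 = 0 := by
    clear * - ha t4 x0 x1 x2 x3 b0 b1 b2 b3 v0 e452 e562 s4560 s4562 e462 e144 e146 s1466 e166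
      e246 e266 s2466 e346 e366 s3466 e136 s1455 e145 e165 e156 s1465 s2465 s3455 s3465 e365 e356
      e135 e164 e264 e364 e154
    grind (ringSteps := 300000)
  have v2 : v 2 = 0 := by
    clear * - ha t4 x0 x1 x2 x3 b0 b1 b2 b3 v0 v1 e452 e266 e236 e235 e165 e164 e264 e154
    grind (ringSteps := 300000)
  have z0 : z 0 = 0 := by
    clear * - ha t4 x0 x1 x2 x3 b0 b1 b2 b3 v0 v1 v2 s0466
    grind (ringSteps := 300000)
  have y0 : y 0 = 0 := by
    clear * - ha t4 x0 x1 x2 x3 b0 b1 b2 b3 v0 v1 v2 z0 s0465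
    grind (ringSteps := 300000)
  clear * - ha t4 x0 x1 x2 x3 b0 b1 b2 b3 v0 v1 v2 z0 y0 e452 e562 e462 s1466 s2466 e560 e563
    s3466 e450 e460 e453 e463 s1455 s1465 s2465 s3455 s3465 e461 e146 e145 e364 e246 e245 e344
    e346 e366 e356 e166 e156 e266 e256 e345 e355 e365 e155 e165 e265
  grind (ringSteps := 300000)

set_option maxHeartbeats 1000000 in
theorem CurvSys.c_of_v
    (h : CurvSys (fun i => prm3 (a i) (b i) (c i) (d i) (v i) (y i) (z i))
      (tab t (-b₆) b₅ a₆ b₆ c₆ (-a₆) 1 0 y₅ y₆ z₆)) :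
    b₆ ≠ 0 → c 4 = 0 ∧ c 6 = 0 ∧ 3 * a 6 + 2 * d 6 = 0 := by
  obtain ⟨c0, c1, c2, c3, c5, x, a0, a1, a2, a3, d0, d1, d2, d3⟩ := h.linear_of_v
  intro hb
  obtain ⟨t0, t1, t2, t3⟩ := h.t_of_v
  have hc := h.c₆_of_v
  have ha := h.a₆_of_v
  have s0450 := h.second 0 4 5 0
  have s1450 := h.second 1 4 5 0
  have s3450 := h.second 3 4 5 0
  have s3466 := h.second 3 4 6 6
  have s2461 := h.second 2 4 6 1
  have e242 := h.def_eq 2 4 2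
  have s2466 := h.second 2 4 6 6
  have s4560 := h.second 4 5 6 0
  have e263 := h.def_eq 2 6 3
  have e450 := h.def_eq 4 5 0
  have e452 := h.def_eq 4 5 2
  have e453 := h.def_eq 4 5 3
  have e460 := h.def_eq 4 6 0
  have e462 := h.def_eq 4 6 2
  have e560 := h.def_eq 5 6 0
  have e562 := h.def_eq 5 6 2
  simp only [Fin.sum_univ_seven, tor, hm_apply, br_apply, tab_apply, prm3_apply, Pi.neg_apply,
    Pi.zero_apply, mul_zero, zero_mul, add_zero, zero_add,
    sub_zero, zero_sub, neg_zero, sub_self, neg_neg, c0, c1, c2, c3, c5, a0, a1, a2, a3, d0, d1,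
    d2, d3, t0, t1, t2, t3, hc, ha] at s0450 s1450 s3450 s3466 s2461 e242 s2466 s4560 e263 e450 e452 e453 e460 e462 e560 e562
  have x0 : x 0 = 0 := by clear * - hb s0450; grind (ringSteps := 300000)
  have x1 : x 1 = 0 := by clear * - hb x0 s1450; grind (ringSteps := 300000)
  have x3 : x 3 = 0 := by clear * - hb x0 x1 s3450; grind (ringSteps := 300000)
  have c6 : c 6 = 0 := by clear * - hb x0 x1 x3 s3466; grind (ringSteps := 300000)
  have x2 : x 2 = 0 := by clear * - hb x0 x1 x3 c6 s2461 e242; grind (ringSteps := 300000)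
  have c4 : c 4 = 0 := by clear * - hb x0 x1 x3 c6 x2 s2466; grind (ringSteps := 300000)
  refine ⟨c4, c6, ?_⟩
  clear * - hb x0 x1 x3 c6 x2 c4 s4560 e263 e450 e452 e453 e460 e462 e560 e562
  grind (ringSteps := 300000)

set_option maxHeartbeats 1000000 in
theorem CurvSys.mul_c_of_v
    (h : CurvSys (fun i => prm3 (a i) (b i) (c i) (d i) (v i) (y i) (z i))
      (tab t (-b₆) b₅ a₆ b₆ c₆ (-a₆) 1 0 y₅ y₆ z₆)) (hb : b₆ = 0) :
    t 4 * c 4 = 0 ∧ t 4 * (3 * a 6 + 2 * d 6) = 0 ∧ t 4 * c 6 = 0 := by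
  obtain ⟨c0, c1, c2, c3, c5, x, a0, a1, a2, a3, d0, d1, d2, d3⟩ := h.linear_of_v
  obtain ⟨t0, t1, t2, t3⟩ := h.t_of_v
  have hc := h.c₆_of_v
  have ha := h.a₆_of_v
  have s2450 := h.second 2 4 5 0
  have s2560 := h.second 2 5 6 0
  have s2561 := h.second 2 5 6 1
  have e562 := h.def_eq 5 6 2
  simp only [Fin.sum_univ_seven, tor, hm_apply, br_apply, tab_apply, prm3_apply, Pi.neg_apply,
    Pi.zero_apply, mul_zero, zero_mul, add_zero, zero_add,
    sub_zero, zero_sub, neg_zero, sub_self, neg_neg, c0, c1, c2, c3, c5, a2,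
    d2, t0, t1, t2, t3, hc, ha, hb] at s2450 s2560 s2561 e562
  have h4 : t 4 * c 4 = 0 := by clear * - s2450; grind (ringSteps := 300000)
  have h5 : t 4 * (3 * a 6 + 2 * d 6) = 0 := by
    clear * - h4 s2560 s2561 e562
    grind (ringSteps := 300000)
  have h6 : t 4 * c 6 = 0 := by clear * - h4 h5 s2560; grind (ringSteps := 300000)
  exact ⟨h4, h5, h6⟩

set_option maxHeartbeats 1000000 in
theorem CurvSys.b₅_mul_c_of_v
    (h : CurvSys (fun i => prm3 (a i) (b i) (c i) (d i) (v i) (y i) (z i))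
      (tab t (-b₆) b₅ a₆ b₆ c₆ (-a₆) 1 0 y₅ y₆ z₆)) (hb : b₆ = 0) (t4 : t 4 = 0) :
    b₅ * c 4 = 0 ∧ b₅ * (3 * a 6 + 2 * d 6) = 0 ∧ b₅ * c 6 = 0 := by
  obtain ⟨c0, c1, c2, c3, c5, x, a0, a1, a2, a3, d0, d1, d2, d3⟩ := h.linear_of_v
  obtain ⟨t0, t1, t2, t3⟩ := h.t_of_v
  have hc := h.c₆_of_v
  have ha := h.a₆_of_v
  have e240 := h.def_eq 2 4 0
  have e142 := h.def_eq 1 4 2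
  have e342 := h.def_eq 3 4 2
  have s2465 := h.second 2 4 6 5
  have s2451 := h.second 2 4 5 1
  have e050 := h.def_eq 0 5 0
  have e150 := h.def_eq 1 5 0
  have e250 := h.def_eq 2 5 0
  have e560 := h.def_eq 5 6 0
  have e141 := h.def_eq 1 4 1
  have e151 := h.def_eq 1 5 1
  have e261 := h.def_eq 2 6 1
  have e361 := h.def_eq 3 6 1
  have e451 := h.def_eq 4 5 1
  have e561 := h.def_eq 5 6 1
  have e562 := h.def_eq 5 6 2
  have e563 := h.def_eq 5 6 3
  have e024 := h.def_eq 0 2 4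
  have e044 := h.def_eq 0 4 4
  have e054 := h.def_eq 0 5 4
  have e134 := h.def_eq 1 3 4
  have e154 := h.def_eq 1 5 4
  have e164 := h.def_eq 1 6 4
  have e234 := h.def_eq 2 3 4
  have e254 := h.def_eq 2 5 4
  have e264 := h.def_eq 2 6 4
  have e364 := h.def_eq 3 6 4
  have e564 := h.def_eq 5 6 4
  have e065 := h.def_eq 0 6 5
  have e255 := h.def_eq 2 5 5
  have e345 := h.def_eq 3 4 5
  have e355 := h.def_eq 3 5 5
  have e365 := h.def_eq 3 6 5
  have e465 := h.def_eq 4 6 5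
  have e046 := h.def_eq 0 4 6
  have e056 := h.def_eq 0 5 6
  have e356 := h.def_eq 3 5 6
  have e366 := h.def_eq 3 6 6
  have e456 := h.def_eq 4 5 6
  have e460 := h.def_eq 4 6 0
  have e452 := h.def_eq 4 5 2
  have e165 := h.def_eq 1 6 5
  have e156 := h.def_eq 1 5 6
  have e266 := h.def_eq 2 6 6
  have e461 := h.def_eq 4 6 1
  have s0455 := h.second 0 4 5 5
  have e256 := h.def_eq 2 5 6
  have s1455 := h.second 1 4 5 5
  have s4560 := h.second 4 5 6 0
  have s0451 := h.second 0 4 5 1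
  have s1451 := h.second 1 4 5 1
  have s3451 := h.second 3 4 5 1
  have s4561 := h.second 4 5 6 1
  simp only [Fin.sum_univ_seven, tor, hm_apply, br_apply, tab_apply, prm3_apply, Pi.neg_apply,
    Pi.zero_apply, mul_zero, zero_mul, add_zero, zero_add,
    sub_zero, zero_sub, neg_zero, sub_self, neg_neg, c0, c1, c2, c3, c5, a0, a1, a2, a3, d0, d1,
    d2, d3, t0, t1, t2, t3, hc, ha, hb, t4] at e240 e142 e342 s2465 s2451 e050 e150 e250 e560 e141 e151 e261 e361 e451 e561 e562 e563 e024 e044 e054 e134 e154 e164 e234 e254 e264 e364 e564 e065 e255 e345 e355 e365 e465 e046 e056 e356 e366 e456 e460 e452 e165 e156 e266 e461 s0455 e256 s1455 s4560 s0451 s1451 s3451 s4561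
  have h4 : b₅ * c 4 = 0 := by clear * - e240 e142 e342 s2465 s2451; grind (ringSteps := 300000)
  have h5 : b₅ * (3 * a 6 + 2 * d 6) = 0 := by
    clear * - h4 e050 e150 e250 e560 e141 e151 e261 e361 e451 e561 e562 e563 e024 e044 e054 e134
      e154 e164 e234 e254 e264 e364 e564 e065 e255 e345 e355 e365 e465 e046 e056 e356 e366 e456
      e460 e452 e165 e156 e266 e461 s0455 e256 s1455 s4560 s0451 s1451 s2451 s3451 s4561
    grind (ringSteps := 300000)
  have h6 : b₅ * c 6 = 0 := by clear * - h4 h5 s4560; grind (ringSteps := 300000)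
  exact ⟨h4, h5, h6⟩

theorem CurvSys.eq_zero_of_v
    (h : CurvSys (fun i => prm3 (a i) (b i) (c i) (d i) (v i) (y i) (z i))
      (tab t (-b₆) b₅ a₆ b₆ c₆ (-a₆) 1 0 y₅ y₆ z₆)) :
    t 0 = 0 ∧ t 1 = 0 ∧ t 2 = 0 ∧ a₆ = 0 ∧ c₆ = 0 ∧
      ((t 3 = 0 ∧ t 4 = 0 ∧ b₅ = 0 ∧ b₆ = 0) ∨ ∀ i, c i = 0) := by
  obtain ⟨c0, c1, c2, c3, c5, -⟩ := h.linear_of_v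
  obtain ⟨t0, t1, t2, t3⟩ := h.t_of_v
  refine ⟨t0, t1, t2, h.a₆_of_v, h.c₆_of_v, ?_⟩
  have key (h4 : c 4 = 0) (h5 : 3 * a 6 + 2 * d 6 = 0) (h6 : c 6 = 0) : ∀ i, c i = 0 := by
    simp only [Fin.forall_fin_succ]
    exact ⟨c0, c1, c2, c3, h4, c5.trans h5, h6, nofun⟩
  by_cases hb : b₆ = 0
  · obtain ⟨h4, h5, h6⟩ := h.mul_c_of_v hb
    by_cases t4 : t 4 = 0
    · obtain ⟨k4, k5, k6⟩ := h.b₅_mul_c_of_v hb t4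
      by_cases hb' : b₅ = 0
      · exact .inl ⟨t3, t4, hb', hb⟩
      · exact .inr (key ((mul_eq_zero.1 k4).resolve_left hb') ((mul_eq_zero.1 k5).resolve_left hb')
          ((mul_eq_zero.1 k6).resolve_left hb'))
    · exact .inr (key ((mul_eq_zero.1 h4).resolve_left t4) ((mul_eq_zero.1 h5).resolve_left t4)
        ((mul_eq_zero.1 h6).resolve_left t4))
  · obtain ⟨h4, h6, h5⟩ := h.c_of_v hb
    exact .inr (key h4 h5 h6)

end Nilpotent

section Obstruction

variable {L : V7 →ₗ[ℝ] M7}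

theorem eq_prm3 {x : Prm ℝ} (h7 : x 7 = 0) (h8 : x 8 = 0) :
    x = prm3 (x 0) (x 1) (x 2) (x 3) (x 4) (x 5) (x 6) := by
  ext i; fin_cases i <;> simp [prm3, h7, h8]

theorem gact_trace {p q r s : ℝ} (h : p * s - q * r = 1) (x : Prm ℝ) :
    gact p q r s x 0 + gact p q r s x 3 = x 0 + x 3 := by
  simp only [gact, prm3_apply]
  linear_combination (x 0 + x 3) * h

theorem Adapted.exists_tab (hL : Adapted L) : ∃ t, rho L = tab t (rho L 4 5 0) (rho L 4 5 1)
    (rho L 4 6 0) (rho L 4 6 1) (rho L 4 6 2) (rho L 4 6 3) (rho L 4 5 4) (rho L 4 6 4)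
    (rho L 4 5 5) (rho L 4 6 5) (rho L 4 6 6) ∧ rho L 4 5 3 = rho L 4 6 1 := by
  have h := (hL.jac.curvSys fun i => (hL.mem (e i)).1).eq_tab
    (fun i j => (hL.rho_eq_zero i j).1) fun i j => (hL.rho_eq_zero i j).2
  exact ⟨_, h, by conv_lhs => rw [h, (tab_apply ..).2.2.2.2.1.2.2.2.2.2.1, (prm3_apply ..).2.2.2.1]⟩

theorem Adapted.curvSys (hL : Adapted L) : CurvSys (fun i => let w := prm (L (e i))
    prm3 (w 0) (w 1) (w 2) (w 3) (w 4) (w 5) (w 6)) (rho L) :=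
  hL.jac.curvSys fun i => by
    rw [← eq_prm3 (hL.mem _).2.1 (hL.mem _).2.2]
    exact (hL.mem _).1

theorem Adapted.trace_eq_zero (hL : Adapted L) :
    rho L 4 5 0 + rho L 4 5 3 = 0 ∧ rho L 4 6 0 + rho L 4 6 3 = 0 := by
  by_contra hne
  obtain ⟨p, q, r, s, h, h5, h6⟩ := exists_sl2 (not_and_or.mp hne)
  have hL' := hL.conj h
  obtain ⟨k5, k6⟩ := hL.rho_conj h
  obtain ⟨t, ht, hd⟩ := hL'.exists_tab
  have hC := hL'.curvSys
  have e5 : rho (conjMap (gm p q r s) (gm s (-q) (-r) p) L) 4 5 0 = 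
      1 - rho (conjMap (gm p q r s) (gm s (-q) (-r) p) L) 4 6 1 := by
    have := gact_trace h (p • rho L 4 5 + q • rho L 4 6)
    rw [← hd, eq_sub_iff_add_eq, k5, this]
    simp only [Pi.add_apply, Pi.smul_apply, smul_eq_mul]
    linarith
  have e6 : rho (conjMap (gm p q r s) (gm s (-q) (-r) p) L) 4 6 3 = 
      -rho (conjMap (gm p q r s) (gm s (-q) (-r) p) L) 4 6 0 := by
    have := gact_trace h (r • rho L 4 5 + s • rho L 4 6)
    rw [eq_neg_iff_add_eq_zero, add_comm, k6, this]
    simp only [Pi.add_apply, Pi.smul_apply, smul_eq_mul]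
    linarith
  rw [ht, e5, e6] at hC
  exact hC.false_of_trace

/-- Membership of the curvature table in a subspace. -/
theorem tab_mem {S : Submodule ℝ (Prm ℝ)} {t : Fin 5 → ℝ}
    {a₅ b₅ a₆ b₆ c₆ d₆ v₅ v₆ y₅ y₆ z₆ : ℝ}
    (h0 : ∀ y z, prm3 0 0 0 0 0 y z ∈ S)
    (h15 : ∀ y z, prm3 (t 2) (t 3) (-t 1) (-t 2) 0 y z ∈ S)
    (h16 : ∀ y z, prm3 (-t 1) (-t 2) (t 0) (t 1) 0 y z ∈ S)
    (h25 : ∀ y z, prm3 (t 3) (t 4) (-t 2) (-t 3) 0 y z ∈ S)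
    (h45 : prm3 a₅ b₅ a₆ b₆ v₅ y₅ y₆ ∈ S) (h46 : prm3 a₆ b₆ c₆ d₆ v₆ y₆ z₆ ∈ S) (i j : Fin 7) :
    tab t a₅ b₅ a₆ b₆ c₆ d₆ v₅ v₆ y₅ y₆ z₆ i j ∈ S := by
  have h26 : ∀ y z, prm3 (-t 2) (-t 3) (t 1) (t 2) 0 y z ∈ S := fun y z => by
    convert S.neg_mem (h15 (-y) (-z)) using 1
    ext i; fin_cases i <;> simp [prm3]
  revert i j
  simp only [Fin.forall_fin_succ, tab]
  simp [h0, h15, h16, h25, h26, h45, h46]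

theorem Adapted.mem_sTr (hL : Adapted L) {x : Prm ℝ} (hx : hm x ∈ infHol L (tb L)) : x ∈ sTr := by
  have hw := fun i => (hL.mem (e i)).1
  refine mem_of_hm_mem hw ?_ (fun i p => br_mem_sTr (hL.mem _).2.1 (hL.mem _).2.2) hx
  obtain ⟨t, ht, hd⟩ := hL.exists_tab
  obtain ⟨h5, h6⟩ := hL.trace_eq_zero
  rw [ht]
  apply tab_mem <;> intros <;> refine ⟨?_, ?_, ?_⟩ <;> simp only [prm3_apply] <;> linarith

theorem gact_gact {p q r s : ℝ} (h : p * s - q * r = 1) {x : Prm ℝ} (h7 : x 7 = 0) (h8 : x 8 = 0) :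
    gact p q r s (gact s (-q) (-r) p x) = x := by
  rw [← prm_hm (gact _ _ _ _ (gact _ _ _ _ _)), ← gm_conj h rfl rfl]
  have h2 := gm_conj (p := s) (q := -q) (r := -r) (s := p) (by linarith) h7 h8
  simp only [neg_neg] at h2
  rw [← h2]
  simp only [Matrix.mul_assoc, gm_mul_inv h, Matrix.mul_one]
  rw [← Matrix.mul_assoc, gm_mul_inv h, Matrix.one_mul, prm_hm]

theorem Adapted.not_forall_mem (hL : Adapted L) :
    ¬ ∀ a b c v y z, hm (prm3 a b c (-a) v y z) ∈ infHol L (tb L) := by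
  intro hall
  have htr := hL.trace_eq_zero
  by_cases hv : rho L 4 5 4 ≠ 0 ∨ rho L 4 6 4 ≠ 0
  · obtain ⟨p, q, r, s, h, h5, h6⟩ := exists_sl2 hv
    have hL' := hL.conj h
    obtain ⟨k5, k6⟩ := hL.rho_conj h
    have hall' : hm (prm3 0 0 1 0 0 0 0) ∈ infHol (conjMap (gm p q r s) (gm s (-q) (-r) p) L)
        (tb (conjMap (gm p q r s) (gm s (-q) (-r) p) L)) := by
      set x := gact s (-q) (-r) p (prm3 0 0 1 0 0 0 0)
      have hx : x 7 = 0 ∧ x 8 = 0 := ⟨rfl, rfl⟩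
      have hx' : x 3 = -x 0 := by
        rw [eq_neg_iff_add_eq_zero, add_comm, gact_trace (by linarith)]
        simp [prm3]
      have := conj_mem_infHol (G := gm p q r s) (by simpa using gm_mul_inv (p := s) (s := p) (q := -q) (r := -r) (by linarith))
        (hall (x 0) (x 1) (x 2) (x 4) (x 5) (x 6))
      rwa [← hx', ← eq_prm3 hx.1 hx.2, gm_conj h hx.1 hx.2, gact_gact h rfl rfl] at this
    obtain ⟨t, ht, hd⟩ := hL'.exists_tab
    have htr' := hL'.trace_eq_zero
    have hC := hL'.curvSys
    have hw := fun i => (hL'.mem (e i)).1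
    have hu := fun i => (hL'.mem (e i)).2
    generalize conjMap (gm p q r s) (gm s (-q) (-r) p) L = L' at *
    have e1 : rho L' 4 5 0 = -rho L' 4 6 1 := by linarith
    have e2 : rho L' 4 6 3 = -rho L' 4 6 0 := by linarith
    have e3 : rho L' 4 5 4 = 1 := by rw [k5]; simpa [gact, prm3] using h5
    have e4 : rho L' 4 6 4 = 0 := by rw [k6]; simpa [gact, prm3] using h6
    rw [e1, e2, e3, e4] at ht
    rw [ht] at hC
    obtain ⟨t0, t1, t2, a6, c6, ⟨t3, t4, b5, b6⟩ | hc⟩ := hC.eq_zero_of_v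
    · have := (mem_of_hm_mem hw (S := sA) (fun i j => ?_) (fun i p => br_mem_sA) hall').2.2.1
      · simp [prm3] at this
      · rw [ht]
        refine tab_mem ?_ ?_ ?_ ?_ ?_ ?_ i j <;> intros <;> refine ⟨?_, ?_, ?_, ?_, ?_, ?_⟩ <;>
          simp [prm3_apply, *]
    · have := (mem_of_hm_mem hw (S := sC) (fun i j => ?_)
        (fun i p => br_mem_sC (hc i) (hu i).1 (hu i).2) hall').2.1
      · simp [prm3] at this
      · rw [ht]
        refine tab_mem ?_ ?_ ?_ ?_ ?_ ?_ i j <;> intros <;> refine ⟨?_, ?_, ?_, ?_⟩ <;>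
          simp [prm3_apply, *]
  · push Not at hv
    obtain ⟨t, ht, hd⟩ := hL.exists_tab
    have := (mem_of_hm_mem (fun i => (hL.mem (e i)).1) (S := sV) (fun i j => ?_)
      (fun i p => br_mem_sV (hL.mem _).2.1 (hL.mem _).2.2) (hall 0 0 0 1 0 0)).2.1
    · simp [prm3] at this
    · rw [ht]
      refine tab_mem ?_ ?_ ?_ ?_ ?_ ?_ i j <;> intros <;> refine ⟨?_, ?_, ?_, ?_⟩ <;>
        simp only [prm3_apply] <;> linarith

/-- The case of a connection with values in `diag ⋉ 𝔪(1,0,2)` extended by `u₂`. -/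
theorem Jac.not_mem_of_diag (hJ : Jac L) (hw : ∀ x, ∃ a d v y z u, L x = hm (prmu a d v y z u))
    (hr : ∀ i j, ∃ p v y z, rho L i j = prm3 p 0 0 0 v y z) {p v y z : ℝ} (hp : p ≠ 0) :
    hm (prm3 p 0 0 0 v y z) ∉ infHol L (tb L) := by
  intro hmem
  choose a d v y z u hw using fun i => hw (e i)
  choose P V Y Z hr using hr
  have hC := hJ.curvSys hw
  have ht := hC.eq_tab (fun i j => by simp [hr, prm3]) (fun i j => by simp [hr, prm3])
  have hd : P 4 6 = 0 := by
    have h := congrFun (congrFun (congrFun ht 4) 5) 2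
    simpa [hr, tab, prm3] using h.symm
  have ht' : rho L = tab 0 (P 4 5) 0 0 0 0 0 (V 4 5) (V 4 6) (Y 4 5) (Y 4 6) (Z 4 6) := by
    have h2 := congrFun (congrFun (congrFun ht 1) 5) 3
    rw [ht]
    congr 1
    · ext i
      fin_cases i <;> simp [hr, prm3]
      simpa [hr, tab, prm3] using h2.symm
    all_goals simp [hr, prm3, hd]
  rw [ht'] at hC
  have hP := hC.eq_zero_of_diag
  refine hp (mem_of_hm_mem hw (S := sA) (fun i j => ?_) (fun i p => br_mem_sA) hmem).1
  rw [ht', hP]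
  refine tab_mem ?_ ?_ ?_ ?_ ?_ ?_ i j <;> intros <;> refine ⟨?_, ?_, ?_, ?_, ?_, ?_⟩ <;>
    simp [prm3_apply]

end Obstruction

section Rescale

/-- The rescaling of `e_4` that relates `hmat` and `hm`. -/
def sc (r : ℝ) : M7 := Matrix.diagonal ![1, 1, 1, r, 1, 1, 1]

theorem sc_inv_mul {r : ℝ} (hr : r ≠ 0) : sc r * sc r⁻¹ = 1 := by
  rw [sc, sc, Matrix.diagonal_mul_diagonal, ← Matrix.diagonal_one]
  congr 1
  ext i; fin_cases i <;> simp [hr]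

theorem sc_hmat (A : M2) (v : ℝ) (u y : Fin 2 → ℝ) : sc (√2)⁻¹ * hmat A v u y * sc √2 =
    hm ![A 0 0, A 0 1, A 1 0, A 1 1, v, y 0, y 1, u 0, u 1] := by
  have h2 : √2 * √2 = 2 := Real.mul_self_sqrt (by norm_num)
  have h0 : √2 ≠ 0 := by positivity
  ext i j
  rw [sc, sc, Matrix.mul_diagonal, Matrix.diagonal_mul]
  revert i j
  simp only [Fin.forall_fin_succ, hmat, hm]
  simp [h0]
  grind

/-- The connection with `e_4` rescaled. -/
abbrev rescaled (L : V7 →ₗ[ℝ] M7) : V7 →ₗ[ℝ] M7 := conjMap (sc (√2)⁻¹) (sc √2) L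

variable {L : V7 →ₗ[ℝ] M7}

theorem hm_mem_rescaled {A : M2} {v : ℝ} {y : Fin 2 → ℝ} (h : h3 A v y ∈ infHol L (tb L)) :
    hm (prm3 (A 0 0) (A 0 1) (A 1 0) (A 1 1) v (y 0) (y 1)) ∈ infHol (rescaled L) (tb (rescaled L)) := by
  have := conj_mem_infHol (G := sc (√2)⁻¹) (sc_inv_mul (r := √2) (by positivity)) h
  rwa [h3, sc_hmat] at this

theorem Jac.rescale (hJ : Jac L) : Jac (rescaled L) := hJ.conj (sc_inv_mul (r := √2) (by positivity))

theorem Jac.adapted (hJ : Jac L) (h : ∀ x, L x ∈ hIII) : Adapted (rescaled L) where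
  jac := hJ.rescale
  mem x := by
    obtain ⟨A, v, y, hx⟩ := h (sc √2 *ᵥ x)
    rw [conjMap_apply, hx, h3, sc_hmat, prm_hm]
    exact ⟨rfl, rfl, rfl⟩

end Rescale

section Stabilizer

theorem Xg2_eq_hmat {s : Fin 14 → ℝ} (h : s 4 = 0 ∧ s 6 = 0 ∧ s 7 = 0 ∧ s 12 = 0 ∧ s 13 = 0) :
    Xg2 s = hmat !![s 0, s 1; s 2, s 3] (s 5) ![s 8, s 9] ![s 10, s 11] := by
  obtain ⟨h4, h6, h7, h12, h13⟩ := h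
  ext i j
  revert i j
  simp only [Fin.forall_fin_succ, hmat, Xg2]
  simp [h4, h6, h7, h12, h13]
  ring

theorem lie_diag {s : Fin 14 → ℝ} {a d : ℝ} {B : M2} {v : ℝ} {y : Fin 2 → ℝ}
    (h : Xg2 s * h3 !![a, 0; 0, d] 0 0 - h3 !![a, 0; 0, d] 0 0 * Xg2 s = h3 B v y) :
    (s 4 * (a + d) = 0 ∧ s 6 * a = 0 ∧ s 7 * d = 0 ∧ s 8 * a = 0 ∧ s 9 * d = 0 ∧
      s 12 * (2 * a + d) = 0 ∧ s 13 * (a + 2 * d) = 0) ∧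
    B 0 1 = s 1 * (d - a) ∧ B 1 0 = s 2 * (a - d) := by
  have h0 : √2 ≠ 0 := by positivity
  have key : ∀ i j, _ := fun i j => congrFun (congrFun h i) j
  have h4 := key 3 0
  have h6 := key 2 0
  have h7 := key 1 0
  have h8 := key 0 2
  have h9 := key 0 1
  have h12 := key 5 0
  have h13 := key 6 0
  have h1 := key 1 2
  have h2 := key 2 1
  clear h key
  simp [h3, hmat, Xg2] at h4 h6 h7 h8 h9 h12 h13 h1 h2
  grind

theorem lie_v {s : Fin 14 → ℝ} {B : M2} {v : ℝ} {y : Fin 2 → ℝ}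
    (h : Xg2 s * h3 0 1 0 - h3 0 1 0 * Xg2 s = h3 B v y) :
    s 7 = 0 ∧ y 1 = 3 * s 9 ∧ B 0 0 + B 1 1 = - 2 * s 4 := by
  have h2 : √2 * √2 = 2 := Real.mul_self_sqrt (by norm_num)
  have h0 : √2 ≠ 0 := by positivity
  have key : ∀ i j, _ := fun i j => congrFun (congrFun h i) j
  have h7 := key 3 5
  have h9 := key 0 6
  have h4 := key 0 0
  clear h key
  simp [h3, hmat, Xg2] at h4 h7 h9
  grind

end Stabilizer

section Exclusion

variable {L : V7 →ₗ[ℝ] M7} {a : Set M2}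

theorem semidir_subset_hIII (a : Set M2) (k : ℕ) : semidir a k ⊆ hIII := by
  intro X hX
  unfold semidir at hX
  split at hX <;> obtain ⟨A, -, v, y, h⟩ := hX <;> exact ⟨A, v, _, h⟩

theorem Xg2_mem_hIII {s : Fin 14 → ℝ} (h : s 4 = 0 ∧ s 6 = 0 ∧ s 7 = 0 ∧ s 12 = 0 ∧ s 13 = 0)
    (h8 : s 8 = 0) (h9 : s 9 = 0) : Xg2 s ∈ hIII :=
  ⟨_, _, _, by rw [Xg2_eq_hmat h, h3, h8, h9]; congr 1; ext i; fin_cases i <;> rfl⟩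

theorem Jac.trace_eq_zero (hJ : Jac L) (h : ∀ x, L x ∈ hIII) {A : M2} {v : ℝ} {y : Fin 2 → ℝ}
    (hA : h3 A v y ∈ infHol L (tb L)) : A 0 0 + A 1 1 = 0 := by
  simpa [prm3] using ((hJ.adapted h).mem_sTr (hm_mem_rescaled hA)).1

theorem Jac.ne_semidir_of_one_mem (hJ : Jac L) (hL : ∀ x, L x ∈ g2star) (h1 : !![1, 0; 0, 1] ∈ a) :
    (infHol L (tb L) : Set M7) ≠ semidir a 2 := by
  intro hS
  have hD : h3 !![1, 0; 0, 1] 0 0 ∈ infHol L (tb L) := by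
    rw [← SetLike.mem_coe, hS]
    exact ⟨_, h1, _, _, rfl⟩
  have hIII : ∀ x, L x ∈ hIII := fun x => by
    obtain ⟨s, hs⟩ := hL x
    have h := lie_mem_infHol x hD
    rw [← SetLike.mem_coe, hS] at h
    obtain ⟨B, v, y, h⟩ := semidir_subset_hIII _ _ h
    rw [← hs] at h ⊢
    have := (lie_diag h).1
    exact Xg2_mem_hIII (by grind) (by grind) (by grind)
  have := hJ.trace_eq_zero hIII hD
  norm_num at this

theorem Jac.ne_semidir_sl2 (hJ : Jac L) (hL : ∀ x, L x ∈ g2star) :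
    (infHol L (tb L) : Set M7) ≠ semidir sl2 2 := by
  intro hS
  have hmem : ∀ {A : M2} v y, A 0 0 + A 1 1 = 0 → h3 A v y ∈ infHol L (tb L) := fun v y hA => by
    rw [← SetLike.mem_coe, hS]
    exact ⟨_, hA, _, _, rfl⟩
  have hIII : ∀ x, L x ∈ hIII := fun x => by
    obtain ⟨s, hs⟩ := hL x
    have hD := lie_mem_infHol x (hmem (A := !![1, 0; 0, -1]) 0 0 (by simp))
    have hV := lie_mem_infHol x (hmem (A := 0) 1 0 (by simp))
    rw [← SetLike.mem_coe, hS, ← hs] at hD hV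
    obtain ⟨B, v, y, hD⟩ := semidir_subset_hIII _ _ hD
    obtain ⟨B', hB', v', y', hV⟩ := hV
    have h1 := (lie_diag hD).1
    have h2 := (lie_v hV).2.2
    have h3 : B' 0 0 + B' 1 1 = 0 := hB'
    rw [← hs]
    exact Xg2_mem_hIII (by grind) (by grind) (by grind)
  refine (hJ.adapted hIII).not_forall_mem fun a b c v y z => ?_
  exact hm_mem_rescaled (hmem (A := !![a, b; c, -a]) v ![y, z] (by simp))

theorem Jac.ne_semidir_rdiag10_one (hJ : Jac L) (hL : ∀ x, L x ∈ g2star) :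
    (infHol L (tb L) : Set M7) ≠ semidir rdiag10 1 := by
  intro hS
  have hmem : ∀ t v, h3 !![t, 0; 0, 0] v 0 ∈ infHol L (tb L) := fun t v => by
    rw [← SetLike.mem_coe, hS]
    exact ⟨_, ⟨t, rfl⟩, v, 0, by congr 1; ext i; fin_cases i <;> rfl⟩
  have hIII : ∀ x, L x ∈ hIII := fun x => by
    obtain ⟨s, hs⟩ := hL x
    have hD := lie_mem_infHol x (hmem 1 0)
    have hV := lie_mem_infHol x (hmem 0 1)
    rw [← SetLike.mem_coe, hS, ← hs] at hD hV
    obtain ⟨B, v, y, hD⟩ := semidir_subset_hIII _ _ hD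
    obtain ⟨B', -, v', y', hV⟩ := hV
    rw [show (!![0, 0; 0, 0] : M2) = 0 from (Matrix.eta_fin_two 0).symm] at hV
    have h1 := (lie_diag hD).1
    have h2 := lie_v hV
    simp at h2
    rw [← hs]
    exact Xg2_mem_hIII (by grind) (by grind) (by grind)
  have := hJ.trace_eq_zero hIII (hmem 1 0)
  norm_num at this

theorem Jac.ne_semidir_rdiag10_two (hJ : Jac L) (hL : ∀ x, L x ∈ g2star) :
    (infHol L (tb L) : Set M7) ≠ semidir rdiag10 2 := by
  intro hS
  have hmem : ∀ t v, h3 !![t, 0; 0, 0] v 0 ∈ infHol L (tb L) := fun t v => by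
    rw [← SetLike.mem_coe, hS]
    exact ⟨_, ⟨t, rfl⟩, v, 0, rfl⟩
  refine hJ.rescale.not_mem_of_diag (fun x => ?_) (fun i j => ?_) one_ne_zero (hm_mem_rescaled (hmem 1 0))
  · obtain ⟨s, hs⟩ := hL (sc √2 *ᵥ x)
    have hD := lie_mem_infHol (sc √2 *ᵥ x) (hmem 1 0)
    have hV := lie_mem_infHol (sc √2 *ᵥ x) (hmem 0 1)
    rw [← SetLike.mem_coe, hS, ← hs] at hD hV
    obtain ⟨B, ⟨t, rfl⟩, v, y, hD⟩ := hD
    obtain ⟨B', -, v', y', hV⟩ := hV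
    rw [show (!![0, 0; 0, 0] : M2) = 0 from (Matrix.eta_fin_two 0).symm] at hV
    have h1 := lie_diag hD
    have h2 := (lie_v hV).1
    simp at h1
    refine ⟨s 0, s 3, s 5, s 10, s 11, s 9, ?_⟩
    rw [conjMap_apply, ← hs, Xg2_eq_hmat (by grind), sc_hmat]
    congr 1
    ext i; fin_cases i <;> simp [prmu, h1]
  · have h := curv_mem_infHol (L := L) (tb L) (sc √2 *ᵥ e i) (sc √2 *ᵥ e j)
    rw [← SetLike.mem_coe, hS] at h
    obtain ⟨A, ⟨t, rfl⟩, v, y, h⟩ := h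
    refine ⟨t, v, y 0, y 1, ?_⟩
    rw [rho, curv_conj (sc_inv_mul (by positivity)), h, h3, sc_hmat, prm_hm]
    rfl

end Exclusion

theorem stmt17 (bk : V7 → V7 → V7) (L : V7 →ₗ[ℝ] M7)
    (hbk : ∀ x y : V7, (L x).mulVec y - (L y).mulVec x = bk x y)
    (halt : ∀ x : V7, bk x x = 0)
    (hjac : ∀ x y z : V7, bk (bk x y) z + bk (bk y z) x + bk (bk z x) y = 0)
    (hL : ∀ x, L x ∈ g2star) :
    (∀ (a : Set M2) (k : ℕ), ListedPair a k → a ≠ ({0} : Set M2) →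
      (infHol L bk : Set M7) ≠ semidir a k) ∧
    (ListedTypeIII (infHol L bk : Set M7) →
      (infHol L bk : Set M7) = m101 ∨ (infHol L bk : Set M7) = m102) := by
  obtain rfl : tb L = bk := funext fun x => funext fun y => hbk x y
  have hJ : Jac L := hjac
  have main : ∀ (a : Set M2) (k : ℕ), ListedPair a k → a ≠ ({0} : Set M2) →
      (infHol L (tb L) : Set M7) ≠ semidir a k := by
    rintro a k (⟨rfl | rfl | rfl | rfl, rfl⟩ | ⟨rfl | rfl, rfl | rfl⟩) ha
    · exact hJ.ne_semidir_sl2 hL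
    · exact hJ.ne_semidir_of_one_mem hL trivial
    · exact hJ.ne_semidir_of_one_mem hL ⟨1, 0, by simp⟩
    · exact hJ.ne_semidir_of_one_mem hL ⟨rfl, rfl⟩
    · exact absurd rfl ha
    · exact absurd rfl ha
    · exact hJ.ne_semidir_rdiag10_one hL
    · exact hJ.ne_semidir_rdiag10_two hL
  refine ⟨main, ?_⟩
  rintro ⟨a, k, hak, hS⟩
  obtain rfl : a = {0} := by_contra fun ha => main a k hak ha hS
  have hk : k = 1 ∨ k = 2 := hak.elim (fun h => Or.inr h.2) And.right
  rw [hS]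
  rcases hk with rfl | rfl
  · exact Or.inl (by simp [semidir, m101])
  · exact Or.inr (by simp [semidir, m102])
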